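/- Let M=(I,V,E) be an iMAG and a∈V. For every b∈V∖{a}: (1) the directed edge I_a→b is in MAG(A_{do(I_a)}) for some A∈[M]_G if and only if a→b is an invisible directed edge of M; (2) the undirected edge I_a−b is in MAG(A_{do(I_a)}) for some A∈[M]_G if and only if a−b is in M; (3) the nodes I_a and b are adjacent in MAG(A_{do(I_a)}) for some A∈[M]_G if and only if a→b is invisible in M or a−b is in M. -/

import Mathlib

noncomputable section
open Classical

/-- Edge-endpoint marks: tail `−`, arrowhead `>`, or circle `∘`. -/
inductive Mark : Type
  | tail
  | arrow
  | circle
  deriving DecidableEq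

/-- A mixed graph with input nodes over a node type `N`, as raw data.
`mark a b` is the mark at `a` on the (unique) edge between `a` and `b`,
or `none` if there is no edge between `a` and `b`. -/
structure MixedGraph (N : Type) where
  inputs : Set N
  outputs : Set N
  mark : N → N → Option Mark

namespace MixedGraph

variable {N N' : Type}

/-- All nodes of the graph. -/
def nodes (G : MixedGraph N) : Set N := G.inputs ∪ G.outputs

/-- `a` and `b` are adjacent (joined by an edge). -/
def adj (G : MixedGraph N) (a b : N) : Prop := (G.mark a b).isSome

/-- Directed edge `a → b`: tail at `a`, arrowhead at `b`. -/
def dir (G : MixedGraph N) (a b : N) : Prop :=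
  G.mark a b = some Mark.tail ∧ G.mark b a = some Mark.arrow

/-- Bidirected edge `a ↔ b`. -/
def bidir (G : MixedGraph N) (a b : N) : Prop :=
  G.mark a b = some Mark.arrow ∧ G.mark b a = some Mark.arrow

/-- Undirected edge `a − b`. -/
def undir (G : MixedGraph N) (a b : N) : Prop :=
  G.mark a b = some Mark.tail ∧ G.mark b a = some Mark.tail

/-- Edge `a ∘→ b`: circle at `a`, arrowhead at `b`. -/
def circArrow (G : MixedGraph N) (a b : N) : Prop :=
  G.mark a b = some Mark.circle ∧ G.mark b a = some Mark.arrow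

/-- Edge `a ∘−∘ b`: circles at both ends. -/
def circCirc (G : MixedGraph N) (a b : N) : Prop :=
  G.mark a b = some Mark.circle ∧ G.mark b a = some Mark.circle

/-- Edge `a ∘− b`: circle at `a`, tail at `b`. -/
def circTail (G : MixedGraph N) (a b : N) : Prop :=
  G.mark a b = some Mark.circle ∧ G.mark b a = some Mark.tail

/-- Edge `a −∘ b`: tail at `a`, circle at `b`. -/
def tailCirc (G : MixedGraph N) (a b : N) : Prop :=
  G.mark a b = some Mark.tail ∧ G.mark b a = some Mark.circle

/-- Some edge of `G` carries an arrowhead at `a`. -/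
def arrowAt (G : MixedGraph N) (a : N) : Prop :=
  ∃ b, G.mark a b = some Mark.arrow

/-- `a` is an ancestor of `b`: `a = b` or a directed path `a → ⋯ → b` exists. -/
def anc (G : MixedGraph N) : N → N → Prop := Relation.ReflTransGen G.dir

/-- The ancestors of a set `S` of nodes. -/
def ancSet (G : MixedGraph N) (S : Set N) : Set N := {a | ∃ s ∈ S, G.anc a s}

/-- Potentially directed edge from `a` towards `b`: an edge with no arrowhead at its
earlier endpoint `a` and no tail at its later endpoint `b`. -/
def potDir (G : MixedGraph N) (a b : N) : Prop :=
  G.adj a b ∧ G.mark a b ≠ some Mark.arrow ∧ G.mark b a ≠ some Mark.tail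

/-- `a` is a possible ancestor of `b`: `a = b` or a potentially directed path runs
from `a` to `b`. -/
def poAn (G : MixedGraph N) : N → N → Prop := Relation.ReflTransGen G.potDir

/-- The possible ancestors of a set `S` of nodes. -/
def poAnSet (G : MixedGraph N) (S : Set N) : Set N := {a | ∃ s ∈ S, G.poAn a s}

/-- Well-formedness of a mixed graph with input nodes: inputs and outputs are disjoint
finite sets, edges are symmetric and irreflexive and join nodes of the graph. -/
def WF (G : MixedGraph N) : Prop :=
  Disjoint G.inputs G.outputs ∧ G.inputs.Finite ∧ G.outputs.Finite ∧
  (∀ a b, (G.mark a b).isSome → (G.mark b a).isSome) ∧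
  (∀ a, G.mark a a = none) ∧
  (∀ a b, (G.mark a b).isSome → a ∈ G.nodes ∧ b ∈ G.nodes)

/-- The induced subgraph of `G` over the node set `A`. -/
def induce (G : MixedGraph N) (A : Set N) : MixedGraph N where
  inputs := G.inputs ∩ A
  outputs := G.outputs ∩ A
  mark := fun a b => if a ∈ A ∧ b ∈ A then G.mark a b else none

/-- Transport a mixed graph over `N` to one over `N ⊕ N'` along `Sum.inl`. -/
def sumInl (G : MixedGraph N) : MixedGraph (N ⊕ N') where
  inputs := Sum.inl '' G.inputs
  outputs := Sum.inl '' G.outputs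
  mark := fun x y =>
    match x, y with
    | Sum.inl a, Sum.inl b => G.mark a b
    | _, _ => none

/-- `G` is a subgraph of `H`: its nodes and marked edges are among those of `H`. -/
def Subgraph (G H : MixedGraph N) : Prop :=
  G.inputs ⊆ H.inputs ∧ G.outputs ⊆ H.outputs ∧
  ∀ a b m, G.mark a b = some m → H.mark a b = some m

end MixedGraph

/-- A walk in `G` with `len` edges, visiting the nodes `f 0, …, f len`
(consecutive nodes are adjacent). -/
structure GWalk {N : Type} (G : MixedGraph N) where
  len : ℕ
  f : ℕ → N
  hadj : ∀ i < len, G.adj (f i) (f (i + 1))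

namespace GWalk

variable {N : Type} {G : MixedGraph N}

/-- The first node of the walk. -/
def first (w : GWalk G) : N := w.f 0

/-- The last node of the walk. -/
def last (w : GWalk G) : N := w.f w.len

/-- The walk is a path: no repeated nodes. -/
def IsPath (w : GWalk G) : Prop :=
  ∀ i ≤ w.len, ∀ j ≤ w.len, w.f i = w.f j → i = j

/-- The (interior) node at position `i` is a collider on the walk: both incident
edges carry arrowheads at it. -/
def ColliderAt (w : GWalk G) (i : ℕ) : Prop :=
  G.mark (w.f i) (w.f (i - 1)) = some Mark.arrow ∧
  G.mark (w.f i) (w.f (i + 1)) = some Mark.arrow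

end GWalk

namespace MixedGraph

variable {N : Type}

/-- `w` is an `(L,S)`-inducing walk: every non-endnode is in `L` or a collider, and
every collider lies in `Anc({first, last} ∪ S)`. -/
def InducingWalk (G : MixedGraph N) (L S : Set N) (w : GWalk G) : Prop :=
  (∀ i, 0 < i → i < w.len → w.f i ∈ L ∨ w.ColliderAt i) ∧
  (∀ i, 0 < i → i < w.len → w.ColliderAt i →
    w.f i ∈ G.ancSet ({w.first, w.last} ∪ S))

/-- There is an `(L,S)`-inducing walk from `a` to `b` in `G`. -/
def InducingWalkBtw (G : MixedGraph N) (L S : Set N) (a b : N) : Prop :=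
  ∃ w : GWalk G, w.first = a ∧ w.last = b ∧ G.InducingWalk L S w

/-- There is an `(L,S)`-inducing path from `a` to `b` in `G`. -/
def InducingPathBtw (G : MixedGraph N) (L S : Set N) (a b : N) : Prop :=
  ∃ w : GWalk G, w.IsPath ∧ w.first = a ∧ w.last = b ∧ G.InducingWalk L S w

/-- `G` is an iADMG: all edges directed or bidirected, no directed cycles, no
arrowheads at input nodes, and no edges between two input nodes. -/
def IsIADMG (G : MixedGraph N) : Prop :=
  G.WF ∧
  (∀ a b, G.adj a b → G.dir a b ∨ G.dir b a ∨ G.bidir a b) ∧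
  (∀ a b, G.dir a b → ¬ G.anc b a) ∧
  (∀ a ∈ G.inputs, ∀ b, G.mark a b ≠ some Mark.arrow) ∧
  (∀ a ∈ G.inputs, ∀ b ∈ G.inputs, ¬ G.adj a b)

/-- `G` is an iPAG. -/
def IsIPAG (G : MixedGraph N) : Prop :=
  G.WF ∧
  (∀ a ∈ G.inputs, ∀ b, G.mark a b ≠ some Mark.arrow) ∧
  (∀ a ∈ G.inputs, ∀ b ∈ G.inputs, ¬ G.adj a b) ∧
  (∀ a b, G.dir a b → ¬ G.anc b a) ∧
  (∀ a b, G.anc a b → ¬ G.bidir b a) ∧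
  (∀ a b c, G.mark b a = some Mark.arrow → ¬ G.undir b c) ∧
  (∀ a b, a ≠ b → a ∈ G.nodes → b ∈ G.nodes → ¬ G.adj a b →
    ¬ G.InducingPathBtw ∅ ∅ a b)

/-- `G` is an iMAG: an iPAG with no circle marks. -/
def IsIMAG (G : MixedGraph N) : Prop :=
  G.IsIPAG ∧ ∀ a b, G.mark a b ≠ some Mark.circle

/-- The visibility condition for a directed edge `a → b` of `G`: either `a` is an
input node, or some node `c` not adjacent to `b` satisfies `c *→ a`, or there is a
path `c *→ v₁ ↔ ⋯ ↔ v_{n−1} ↔ a` (`n ≥ 2`) with every `vᵢ` a parent of `b`. -/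
def VisibleCond (G : MixedGraph N) (a b : N) : Prop :=
  a ∈ G.inputs ∨
  ∃ c, c ≠ b ∧ ¬ G.adj c b ∧
    (G.mark a c = some Mark.arrow ∨
      ∃ w : GWalk G, w.IsPath ∧ 2 ≤ w.len ∧ w.first = c ∧ w.last = a ∧
        G.mark (w.f 1) (w.f 0) = some Mark.arrow ∧
        (∀ i, 1 ≤ i → i < w.len → G.bidir (w.f i) (w.f (i + 1))) ∧
        (∀ i, 1 ≤ i → i < w.len → G.dir (w.f i) b))

/-- `a → b` is a visible directed edge of `G`. -/
def VisibleDir (G : MixedGraph N) (a b : N) : Prop :=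
  G.dir a b ∧ G.VisibleCond a b

/-- `a` and `b` are in the same bucket of `G`: some path between them carries no
arrowhead mark on any of its edges. -/
def SameBucket (G : MixedGraph N) (a b : N) : Prop :=
  ∃ w : GWalk G, w.IsPath ∧ w.first = a ∧ w.last = b ∧
    ∀ i < w.len, G.mark (w.f i) (w.f (i + 1)) ≠ some Mark.arrow ∧
      G.mark (w.f (i + 1)) (w.f i) ≠ some Mark.arrow

end MixedGraph

/-- An isADMG: an iADMG together with its set `sel` of latent selection nodes.
The observed output nodes are `graph.outputs \ sel`. -/
structure SADMG (N : Type) where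
  graph : MixedGraph N
  sel : Set N

namespace SADMG

/-- Well-formedness of an isADMG. -/
def WF {N : Type} (A : SADMG N) : Prop :=
  A.graph.IsIADMG ∧ A.sel ⊆ A.graph.outputs

/-- The observed output nodes `O`. -/
def obs {N : Type} (A : SADMG N) : Set N := A.graph.outputs \ A.sel

end SADMG

/-- An ilsADMG: an iADMG together with its sets of latent output nodes and of
latent selection nodes.  The observed output nodes are the remaining outputs. -/
structure LSADMG (N : Type) where
  graph : MixedGraph N
  latent : Set N
  sel : Set N

namespace LSADMG

/-- Well-formedness of an ilsADMG. -/
def WF {N : Type} (A : LSADMG N) : Prop :=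
  A.graph.IsIADMG ∧ A.latent ⊆ A.graph.outputs ∧ A.sel ⊆ A.graph.outputs ∧
  Disjoint A.latent A.sel

/-- The observed output nodes `O`. -/
def obs {N : Type} (A : LSADMG N) : Set N := A.graph.outputs \ (A.latent ∪ A.sel)

end LSADMG

/-- An iPAG/iMAG `P` represents the isADMG `A`: nodes match; adjacency in `P`
corresponds exactly to `S`-inducing paths in `A` (with no edges inside the inputs);
arrowheads at `a` imply `a ∉ Anc_A({b} ∪ S)`; tails at `a` imply `a ∈ Anc_A({b} ∪ S)`. -/
def RepresentsS {N : Type} (P : MixedGraph N) (A : SADMG N) : Prop :=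
  P.inputs = A.graph.inputs ∧
  P.outputs = A.obs ∧
  (∀ a b, a ≠ b → a ∈ P.nodes → b ∈ P.nodes →
    (P.adj a b ↔
      (¬(a ∈ P.inputs ∧ b ∈ P.inputs) ∧ A.graph.InducingPathBtw ∅ A.sel a b))) ∧
  (∀ a b, P.mark a b = some Mark.arrow → a ∉ A.graph.ancSet ({b} ∪ A.sel)) ∧
  (∀ a b, P.mark a b = some Mark.tail → a ∈ A.graph.ancSet ({b} ∪ A.sel))

/-- An iPAG/iMAG `P` `(L,S)`-represents the ilsADMG `A`. -/
def RepresentsLS {N : Type} (P : MixedGraph N) (A : LSADMG N) : Prop :=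
  P.inputs = A.graph.inputs ∧
  P.outputs = A.obs ∧
  (∀ a b, a ≠ b → a ∈ P.nodes → b ∈ P.nodes →
    (P.adj a b ↔
      (¬(a ∈ P.inputs ∧ b ∈ P.inputs) ∧ A.graph.InducingPathBtw A.latent A.sel a b))) ∧
  (∀ a b, P.mark a b = some Mark.arrow → a ∉ A.graph.ancSet ({b} ∪ A.sel)) ∧
  (∀ a b, P.mark a b = some Mark.tail → a ∈ A.graph.ancSet ({b} ∪ A.sel))

/-- The explicit candidate for `MAG(A)` of an ilsADMG `A`: input nodes `I`, output
nodes `O`; distinct `a,b ∈ I ∪ O` adjacent iff `{a,b} ⊄ I` and there is an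
`(L,S)`-inducing path between them in `A`; the mark at `a` on each edge is a tail
if `a ∈ Anc_A({b} ∪ S)` and an arrowhead otherwise. -/
def magOfLS {N : Type} (A : LSADMG N) : MixedGraph N where
  inputs := A.graph.inputs
  outputs := A.obs
  mark := fun a b =>
    if a ≠ b ∧ a ∈ A.graph.inputs ∪ A.obs ∧ b ∈ A.graph.inputs ∪ A.obs ∧
        ¬(a ∈ A.graph.inputs ∧ b ∈ A.graph.inputs) ∧
        A.graph.InducingPathBtw A.latent A.sel a b then
      (if a ∈ A.graph.ancSet ({b} ∪ A.sel) then some Mark.tail else some Mark.arrow)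
    else none

/-- A walk is `C`-open (in a graph without circle marks): its endnodes are not in
`C`, no non-collider on it is in `C`, and every collider on it is in `Anc(C)`. -/
def COpen {N : Type} (H : MixedGraph N) (C : Set N) (w : GWalk H) : Prop :=
  w.first ∉ C ∧ w.last ∉ C ∧
  ∀ i, 0 < i → i < w.len →
    (¬ w.ColliderAt i → w.f i ∉ C) ∧ (w.ColliderAt i → w.f i ∈ H.ancSet C)

/-- `A` is id-separated from `B` given `C` in `H` (graphs without circle marks):
every path/walk from a node of `A` to a node of `B ∪ inputs` is not `C`-open. -/
def IdSepSimple {N : Type} (H : MixedGraph N) (A B C : Set N) : Prop :=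
  ∀ w : GWalk H, w.first ∈ A → w.last ∈ B ∪ H.inputs → ¬ COpen H C w

/-- A walk in a manipulated graph `H` (with set `DI` of regime input nodes) is
`C`-id-open. -/
def IdOpen {N : Type} (H : MixedGraph N) (DI C : Set N) (w : GWalk H) : Prop :=
  w.first ∉ C ∧ w.last ∉ C ∧
  ∀ i, 0 < i → i < w.len →
    (w.f i ∉ C ∧ (H.mark (w.f i) (w.f (i - 1)) = some Mark.tail ∨
        H.mark (w.f i) (w.f (i + 1)) = some Mark.tail)) ∨
    (w.f i ∉ C ∧ H.mark (w.f i) (w.f (i - 1)) = some Mark.circle ∧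
        H.mark (w.f i) (w.f (i + 1)) = some Mark.circle ∧
        ¬ H.adj (w.f (i - 1)) (w.f (i + 1))) ∨
    (w.ColliderAt i ∧ w.f (i - 1) ∉ DI ∧ w.f i ∉ DI ∧ w.f (i + 1) ∉ DI ∧
        w.f i ∈ H.ancSet C) ∨
    (w.ColliderAt i ∧ ¬(w.f (i - 1) ∉ DI ∧ w.f i ∉ DI ∧ w.f (i + 1) ∉ DI) ∧
        w.f i ∈ H.poAnSet (C ∩ H.outputs)) ∨
    (w.f (i - 1) ∈ DI ∧ H.mark (w.f i) (w.f (i - 1)) = some Mark.circle ∧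
        H.mark (w.f i) (w.f (i + 1)) = some Mark.arrow ∧
        w.f i ∈ H.poAnSet (C ∩ H.outputs)) ∨
    (w.f (i + 1) ∈ DI ∧ H.mark (w.f i) (w.f (i - 1)) = some Mark.arrow ∧
        H.mark (w.f i) (w.f (i + 1)) = some Mark.circle ∧
        w.f i ∈ H.poAnSet (C ∩ H.outputs))

/-- `A` is id-separated from `B` given `C` in the manipulated graph `H`, whose set
of regime input nodes is `DI`: every path/walk from a node of `A` to a node of
`B ∪ inputs` is not `C`-id-open. -/
def IdSep {N : Type} (H : MixedGraph N) (DI A B C : Set N) : Prop :=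
  ∀ w : GWalk H, w.first ∈ A → w.last ∈ B ∪ H.inputs → ¬ IdOpen H DI C w

/-- Hard manipulation `do(T)` of an isADMG-type graph: reclassify the nodes of `T`
as input nodes and delete every edge with an arrowhead at a node of `T`. -/
def admgHardManip {N : Type} (G : MixedGraph N) (T : Set N) : MixedGraph N where
  inputs := G.inputs ∪ (T ∩ G.outputs)
  outputs := G.outputs \ T
  mark := fun x y =>
    if (x ∈ T ∧ G.mark x y = some Mark.arrow) ∨
        (y ∈ T ∧ G.mark y x = some Mark.arrow) then none
    else G.mark x y

/-- Soft manipulation `do(I_D)` of an isADMG-type graph: add a fresh input node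
`I_d = Sum.inr d` and the directed edge `I_d → d` for each `d ∈ D`. -/
def admgSoftManip {N : Type} (G : MixedGraph N) (D : Set N) : MixedGraph (N ⊕ N) where
  inputs := Sum.inl '' G.inputs ∪ Sum.inr '' D
  outputs := Sum.inl '' G.outputs
  mark := fun x y =>
    match x, y with
    | Sum.inl a, Sum.inl b => G.mark a b
    | Sum.inr d, Sum.inl a => if d ∈ D ∧ a = d then some Mark.tail else none
    | Sum.inl a, Sum.inr d => if d ∈ D ∧ a = d then some Mark.arrow else none
    | Sum.inr _, Sum.inr _ => none

/-- Soft manipulation of an isADMG. -/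
def SADMG.softManip {N : Type} (A : SADMG N) (D : Set N) : SADMG (N ⊕ N) where
  graph := admgSoftManip A.graph D
  sel := Sum.inl '' A.sel

/-- Hard manipulation `do(T)` of an iMAG-type graph: input nodes `I ∪ (T ∩ V)`,
output nodes `V \ T`; delete all edges with an arrowhead at a node of `T \ I` and
all edges between two nodes of `T ∪ I`. -/
def magHardManip {N : Type} (G : MixedGraph N) (T : Set N) : MixedGraph N where
  inputs := G.inputs ∪ (T ∩ G.outputs)
  outputs := G.outputs \ T
  mark := fun x y =>
    if (x ∈ T ∧ x ∉ G.inputs ∧ G.mark x y = some Mark.arrow) ∨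
        (y ∈ T ∧ y ∉ G.inputs ∧ G.mark y x = some Mark.arrow) ∨
        ((x ∈ T ∨ x ∈ G.inputs) ∧ (y ∈ T ∨ y ∈ G.inputs)) then none
    else G.mark x y

/-- The mark at node `y` on the new edge between the regime node `I_a = Sum.inr a`
and `y` in the soft manipulation of an iMAG-type graph `G` over `N ⊕ N`
(`none` if there is no such edge): `I_a → a` if some edge of `G` has an arrowhead
at `a`; `I_a − a` if some undirected edge is at `a`; `I_a −∘ a` otherwise;
`I_a → b` for every output `b` with `a → b` invisible; `I_a − b` for every output
`b` with `a − b` in `G`. -/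
def magSoftTarget {N : Type} (G : MixedGraph (N ⊕ N)) (a : N) (y : N ⊕ N) : Option Mark :=
  if y = Sum.inl a then
    (if G.arrowAt (Sum.inl a) then some Mark.arrow
     else if ∃ c, G.undir (Sum.inl a) c then some Mark.tail
     else some Mark.circle)
  else if y ∈ G.outputs ∧ G.dir (Sum.inl a) y ∧ ¬ G.VisibleCond (Sum.inl a) y then
    some Mark.arrow
  else if y ∈ G.outputs ∧ G.undir (Sum.inl a) y then some Mark.tail
  else none

/-- The mark at node `y` on the new edge between the regime node `I_a = Sum.inr a`
and `y` in the soft manipulation of an iPAG-type graph `G` over `N ⊕ N`. -/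
def pagSoftTarget {N : Type} (G : MixedGraph (N ⊕ N)) (a : N) (y : N ⊕ N) : Option Mark :=
  if y = Sum.inl a then
    (if G.arrowAt (Sum.inl a) then some Mark.arrow
     else if ∃ c, G.undir (Sum.inl a) c then some Mark.tail
     else some Mark.circle)
  else if y ∈ G.outputs ∧ ((G.dir (Sum.inl a) y ∧ ¬ G.VisibleCond (Sum.inl a) y) ∨
      G.circArrow (Sum.inl a) y) then some Mark.arrow
  else if y ∈ G.outputs ∧ (G.undir (Sum.inl a) y ∨
      (G.circTail (Sum.inl a) y ∧ ∃ c, G.undir c y)) then some Mark.tail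
  else if y ∈ G.outputs ∧ (G.tailCirc (Sum.inl a) y ∨ G.circCirc (Sum.inl a) y ∨
      (G.circTail (Sum.inl a) y ∧ ¬ ∃ c, G.undir c y)) then some Mark.circle
  else none

/-- Generic soft-manipulation step on a graph over `N ⊕ N`: for each `a ∈ A` not
already an input, the regime node `I_a = Sum.inr a` is added as an input node,
with edges (and end marks) prescribed by `target`; the mark at `I_a` on each new
edge is a tail. -/
def softManipStep {N : Type}
    (target : MixedGraph (N ⊕ N) → N → (N ⊕ N) → Option Mark)
    (G : MixedGraph (N ⊕ N)) (A : Set N) : MixedGraph (N ⊕ N) where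
  inputs := G.inputs ∪ Sum.inr '' {a | a ∈ A ∧ Sum.inl a ∉ G.inputs}
  outputs := G.outputs
  mark := fun x y =>
    match x, y with
    | Sum.inr a, Sum.inr b =>
        if a ∈ A ∧ Sum.inl a ∉ G.inputs then
          (if (target G a (Sum.inr b)).isSome then some Mark.tail else none)
        else if b ∈ A ∧ Sum.inl b ∉ G.inputs then target G b (Sum.inr a)
        else G.mark x y
    | Sum.inr a, Sum.inl v =>
        if a ∈ A ∧ Sum.inl a ∉ G.inputs then
          (if (target G a (Sum.inl v)).isSome then some Mark.tail else none)
        else G.mark x y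
    | Sum.inl v, Sum.inr a =>
        if a ∈ A ∧ Sum.inl a ∉ G.inputs then target G a (Sum.inl v)
        else G.mark x y
    | Sum.inl _, Sum.inl _ => G.mark x y

/-- Soft-manipulation step for iMAG-type graphs over `N ⊕ N`. -/
def magSoftManipStep {N : Type} (G : MixedGraph (N ⊕ N)) (A : Set N) :
    MixedGraph (N ⊕ N) :=
  softManipStep magSoftTarget G A

/-- The soft-manipulated iMAG `M_{do(I_A)}`, over node type `N ⊕ N`. -/
def magSoftManip {N : Type} (M : MixedGraph N) (A : Set N) : MixedGraph (N ⊕ N) :=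
  magSoftManipStep M.sumInl A

/-- The soft-manipulated iPAG `P_{do(I_A)}`, over node type `N ⊕ N`. -/
def pagSoftManip {N : Type} (P : MixedGraph N) (A : Set N) : MixedGraph (N ⊕ N) :=
  softManipStep pagSoftTarget P.sumInl A

/-- Hard manipulation `do(T)` of an iPAG-type graph: as for iMAGs, but in addition
every remaining circle mark at a manipulated node is replaced by a tail. -/
def pagHardManip {N : Type} (G : MixedGraph N) (T : Set N) : MixedGraph N where
  inputs := G.inputs ∪ T
  outputs := G.outputs \ T
  mark := fun x y =>
    if (x ∈ T ∧ x ∉ G.inputs ∧ G.mark x y = some Mark.arrow) ∨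
        (y ∈ T ∧ y ∉ G.inputs ∧ G.mark y x = some Mark.arrow) ∨
        ((x ∈ T ∨ x ∈ G.inputs) ∧ (y ∈ T ∨ y ∈ G.inputs)) then none
    else if x ∈ T ∧ x ∉ G.inputs ∧ y ∈ G.outputs ∧ y ∉ T ∧
        G.mark x y = some Mark.circle then some Mark.tail
    else G.mark x y

/-- Orient all circle marks of `G` as tails. -/
def orientCirclesTails {N : Type} (G : MixedGraph N) : MixedGraph N :=
  { G with
    mark := fun x y =>
      (G.mark x y).map (fun m => if m = Mark.circle then Mark.tail else m) }

/-- There is a pc-connecting path from `a` to `b` in `G`: a single edge between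
`a` and `b` that is not a visible directed edge, or a path
`a *→ v₁ ↔ ⋯ ↔ v_{n−1} ←* b` (`n > 1`) none of whose edges is visible directed. -/
def PcConn {N : Type} (G : MixedGraph N) (a b : N) : Prop :=
  (G.adj a b ∧ ¬ G.VisibleDir a b ∧ ¬ G.VisibleDir b a) ∨
  (∃ w : GWalk G, w.IsPath ∧ 1 < w.len ∧ w.first = a ∧ w.last = b ∧
    G.mark (w.f 1) (w.f 0) = some Mark.arrow ∧
    G.mark (w.f (w.len - 1)) (w.f w.len) = some Mark.arrow ∧
    (∀ i, 1 ≤ i → i < w.len - 1 → G.bidir (w.f i) (w.f (i + 1))) ∧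
    (∀ i < w.len, ¬ G.VisibleDir (w.f i) (w.f (i + 1)) ∧
      ¬ G.VisibleDir (w.f (i + 1)) (w.f i)))

/-- The pc-component of `b` in `G`. -/
def pcSet {N : Type} (G : MixedGraph N) (b : N) : Set N := {a | PcConn G a b}

/-- The region of a set `B` in `G`: all nodes in the bucket of some node
pc-connected to a node of `B`. -/
def regionSet {N : Type} (G : MixedGraph N) (B : Set N) : Set N :=
  {a | ∃ b ∈ B, ∃ c, PcConn G c b ∧ G.SameBucket a c}

/-- `S` is a bucket of `G`. -/
def IsBucket {N : Type} (G : MixedGraph N) (S : Set N) : Prop :=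
  ∃ a ∈ G.nodes, S = {x | G.SameBucket x a}

/-- FCI rule R1 (closure form): if `k *→ j` with the edge between `j` and `i`
carrying a circle at `j`, `i` and `k` non-adjacent and `i` not an input node,
then that edge is `j → i`. -/
def FciR1 {N : Type} (P : MixedGraph N) : Prop :=
  ∀ i j k, P.mark j k = some Mark.arrow → ¬ P.adj i k → i ∉ P.inputs →
    P.mark j i = some Mark.circle → P.dir j i

/-- FCI rule R2 (closure form): if `i → j *→ k` or `i *→ j → k` with the edge
between `i` and `k` carrying a circle at `k`, then that edge has an arrowhead at `k`. -/
def FciR2 {N : Type} (P : MixedGraph N) : Prop :=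
  ∀ i j k, ((P.dir i j ∧ P.mark k j = some Mark.arrow) ∨
      (P.mark j i = some Mark.arrow ∧ P.dir j k)) →
    P.mark k i = some Mark.circle → P.mark k i = some Mark.arrow

/-- FCI rule R4 (closure form): for every discriminating path `⟨a,…,y,z⟩` for `y`,
the mark at `y` on the edge between `y` and `z` is not a circle. -/
def FciR4 {N : Type} (P : MixedGraph N) : Prop :=
  ∀ w : GWalk P, w.IsPath → 3 ≤ w.len → ¬ P.adj (w.f 0) (w.f w.len) →
    (∀ i, 0 < i → i < w.len - 1 → w.ColliderAt i ∧ P.dir (w.f i) (w.f w.len)) →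
    P.mark (w.f (w.len - 1)) (w.f w.len) ≠ some Mark.circle

/-- Property (P2) of iSOPAGs: no `a *→ b` together with `b −∘ c`, and no
`a *→ b` together with `b ∘− c`. -/
def SopagP2 {N : Type} (P : MixedGraph N) : Prop :=
  ∀ a b c, P.mark b a = some Mark.arrow → ¬ P.tailCirc b c ∧ ¬ P.circTail b c

/-- Property (P3) of iSOPAGs: if `a *→ b` and the edge between `b` and `c` has a
circle at `b`, then `a *→ c`. -/
def SopagP3 {N : Type} (P : MixedGraph N) : Prop :=
  ∀ a b c, P.mark b a = some Mark.arrow → P.mark b c = some Mark.circle →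
    P.mark c a = some Mark.arrow

/-- `P` is an iSOPAG: an iPAG representing some isADMG, closed under the FCI
orientation rules (R1, R2, R4), and satisfying (P2) and (P3). -/
def IsISOPAG {N : Type} (P : MixedGraph N) : Prop :=
  P.IsIPAG ∧ (∃ A : SADMG N, A.WF ∧ RepresentsS P A) ∧
  FciR1 P ∧ FciR2 P ∧ FciR4 P ∧ SopagP2 P ∧ SopagP3 P

/-- A sequence whose consecutive entries satisfy `E` and whose interior entries satisfy `B`
towards both neighbours can be shortened to one without repetitions. -/
theorem exists_injective_seq {N : Type} {E B : N → N → Prop} {a b : N} {n : ℕ} {f : ℕ → N}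
    (h0 : f 0 = a) (hn : f n = b) (hE : ∀ i < n, E (f i) (f (i + 1)))
    (hB : ∀ i, 0 < i → i < n → B (f i) (f (i - 1)) ∧ B (f i) (f (i + 1))) :
    ∃ (n : ℕ) (f : ℕ → N), f 0 = a ∧ f n = b ∧ (∀ i < n, E (f i) (f (i + 1))) ∧
      (∀ i, 0 < i → i < n → B (f i) (f (i - 1)) ∧ B (f i) (f (i + 1))) ∧
      ∀ i ≤ n, ∀ j ≤ n, f i = f j → i = j := by
  induction n using Nat.strong_induction_on generalizing f with
  | _ n ih =>
  by_cases hinj : ∀ i ≤ n, ∀ j ≤ n, f i = f j → i = j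
  · exact ⟨n, f, h0, hn, hE, hB, hinj⟩
  push Not at hinj
  obtain ⟨i, hi, j, hj, hij, hne⟩ := hinj
  wlog hlt : i < j generalizing i j
  · exact this j hj i hi hij.symm hne.symm (by omega)
  obtain ⟨d, rfl⟩ : ∃ d, j = i + d := ⟨j - i, by omega⟩
  let g : ℕ → N := fun k => if k ≤ i then f k else f (k + d)
  have g1 : ∀ k, k ≤ i → g k = f k := fun k hk => by simp [g, hk]
  have g2 : ∀ k, i ≤ k → g k = f (k + d) := by
    intro k hk
    rcases hk.eq_or_lt with rfl | hk
    · rw [g1 _ le_rfl, hij]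
    · simp [g, not_le.2 hk]
  refine ih (n - d) (by omega) (f := g) ?_ ?_ ?_ ?_
  · rw [g1 _ (Nat.zero_le _), h0]
  · rw [g2 _ (by omega), Nat.sub_add_cancel (by omega), hn]
  · intro k hk
    rcases lt_or_ge k i with h | h
    · rw [g1 _ h.le, g1 _ h]; exact hE k (by omega)
    · rw [g2 _ h, g2 _ (by omega), add_right_comm]; exact hE (k + d) (by omega)
  · intro k hk0 hk
    constructor
    · rcases le_or_gt k i with h | h
      · rw [g1 _ h, g1 _ (by omega)]; exact (hB k hk0 (by omega)).1
      · rw [g2 _ h.le, g2 _ (by omega), show k - 1 + d = k + d - 1 by omega]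
        exact (hB (k + d) (by omega) (by omega)).1
    · rcases lt_or_ge k i with h | h
      · rw [g1 _ h.le, g1 _ h]; exact (hB k hk0 (by omega)).2
      · rw [g2 _ h, g2 _ (by omega), add_right_comm]
        exact (hB (k + d) (by omega) (by omega)).2

theorem exists_injective_seq_of_reflTransGen {N : Type} {r : N → N → Prop} {a b : N}
    (h : Relation.ReflTransGen r a b) :
    ∃ (n : ℕ) (f : ℕ → N), f 0 = a ∧ f n = b ∧ (∀ i < n, r (f i) (f (i + 1))) ∧
      ∀ i ≤ n, ∀ j ≤ n, f i = f j → i = j := by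
  have key : ∃ (n : ℕ) (f : ℕ → N), f 0 = a ∧ f n = b ∧ ∀ i < n, r (f i) (f (i + 1)) := by
    induction h with
    | refl => exact ⟨0, fun _ => a, rfl, rfl, by simp⟩
    | @tail c d _ hcd ih =>
      obtain ⟨n, f, h0, hn, hr⟩ := ih
      refine ⟨n + 1, fun k => if k ≤ n then f k else d, by simpa using h0, by simp, ?_⟩
      intro i hi
      rcases (Nat.lt_succ_iff.1 hi).eq_or_lt with rfl | h
      · simpa [hn] using hcd
      · simpa [h.le, Nat.succ_le_of_lt h] using hr i h
  obtain ⟨n, f, h0, hn, hr⟩ := key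
  obtain ⟨n, f, h0, hn, hr, -, hinj⟩ :=
    exists_injective_seq (B := fun _ _ => True) h0 hn hr (fun _ _ _ => ⟨trivial, trivial⟩)
  exact ⟨n, f, h0, hn, hr, hinj⟩

namespace MixedGraph

variable {N : Type} {G : MixedGraph N}

/-- There is a walk `x *→ v₁ ↔ ⋯ ↔ v` whose nodes strictly between `x` and `v` lie in `X`. -/
inductive ColliderChain (G : MixedGraph N) (X : Set N) (x : N) : N → Prop
  | single {v : N} : G.mark v x = some Mark.arrow → ColliderChain G X x v
  | step {w v : N} : ColliderChain G X x w → w ∈ X → G.bidir w v → ColliderChain G X x v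

/-- There is a walk `u ↔ ⋯ ↔ v` all of whose nodes except possibly `v` lie in `X`. -/
def BidirChain (G : MixedGraph N) (X : Set N) : N → N → Prop :=
  Relation.ReflTransGen fun p q => p ∈ X ∧ G.bidir p q

/-- Walk form of the existence of an `S`-inducing path between `x` and `y`. -/
def Inducing (G : MixedGraph N) (S : Set N) (x y : N) : Prop :=
  G.adj x y ∨ ∃ v ∈ G.ancSet ({x, y} ∪ S),
    G.ColliderChain (G.ancSet ({x, y} ∪ S)) x v ∧ G.mark v y = some Mark.arrow

theorem adj_symm (hG : G.WF) {x y : N} (h : G.adj x y) : G.adj y x := hG.2.2.2.1 x y h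

theorem adj_of_mark {x y : N} {m : Mark} (h : G.mark x y = some m) : G.adj x y := by
  simp [adj, h]

theorem bidir_symm {x y : N} (h : G.bidir x y) : G.bidir y x := ⟨h.2, h.1⟩

theorem mem_ancSet_self {S : Set N} {x : N} (h : x ∈ S) : x ∈ G.ancSet S :=
  ⟨x, h, Relation.ReflTransGen.refl⟩

theorem mem_ancSet_of_anc {S : Set N} {x y : N} (h : G.anc x y) (hy : y ∈ G.ancSet S) :
    x ∈ G.ancSet S := by
  obtain ⟨s, hs, hys⟩ := hy
  exact ⟨s, hs, h.trans hys⟩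

theorem ancSet_subset_ancSet {S T : Set N} (h : S ⊆ G.ancSet T) : G.ancSet S ⊆ G.ancSet T := by
  rintro x ⟨s, hs, hxs⟩
  exact mem_ancSet_of_anc hxs (h hs)

theorem ancSet_mono {S T : Set N} (h : S ⊆ T) : G.ancSet S ⊆ G.ancSet T :=
  ancSet_subset_ancSet fun _ hx => mem_ancSet_self (h hx)

theorem ColliderChain.mono {X Y : Set N} {x v : N} (h : G.ColliderChain X x v) (hXY : X ⊆ Y) :
    G.ColliderChain Y x v := by
  induction h with
  | single h => exact .single h
  | step _ hw hb ih => exact .step ih (hXY hw) hb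

theorem BidirChain.mono {X Y : Set N} {x v : N} (h : G.BidirChain X x v) (hXY : X ⊆ Y) :
    G.BidirChain Y x v := by
  induction h with
  | refl => exact .refl
  | tail _ hr ih => exact ih.tail ⟨hXY hr.1, hr.2⟩

theorem ColliderChain.trans {X : Set N} {x u v : N} (h : G.ColliderChain X x u)
    (h' : G.BidirChain X u v) : G.ColliderChain X x v := by
  induction h' with
  | refl => exact h
  | tail _ hr ih => exact .step ih hr.1 hr.2

theorem BidirChain.symm {X : Set N} {u v : N} (h : G.BidirChain X u v) (hv : v ∈ X) :
    G.BidirChain X v u := by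
  induction h with
  | refl => exact .refl
  | tail _ hr ih => exact (Relation.ReflTransGen.single ⟨hv, bidir_symm hr.2⟩).trans (ih hr.1)

theorem BidirChain.eq_or_colliderChain {X : Set N} {u v : N} (h : G.BidirChain X u v) :
    v = u ∨ G.ColliderChain X u v := by
  induction h with
  | refl => exact .inl rfl
  | tail _ hr ih =>
    rcases ih with rfl | ih
    · exact .inr (.single hr.2.2)
    · exact .inr (.step ih hr.1 hr.2)

theorem ColliderChain.arrowAt {X : Set N} {x v : N} (h : G.ColliderChain X x v) :
    G.arrowAt v := by
  cases h with
  | single h => exact ⟨_, h⟩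
  | step _ _ hb => exact ⟨_, hb.2⟩

/-- Two chains meeting at a common node of `X` join to a walk between their starting points. -/
theorem ColliderChain.exists_meet {X : Set N} {x y v : N} (hx : G.ColliderChain X x v)
    (hy : G.ColliderChain X y v) (hv : v ∈ X) :
    ∃ u ∈ X, G.ColliderChain X y u ∧ G.mark u x = some Mark.arrow := by
  induction hx with
  | single h => exact ⟨_, hv, hy, h⟩
  | step _ hw hb ih => exact ih (.step hy hv (bidir_symm hb)) hw

theorem ColliderChain.inducing {S : Set N} {x y v : N}
    (hx : G.ColliderChain (G.ancSet ({x, y} ∪ S)) x v)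
    (hy : G.ColliderChain (G.ancSet ({x, y} ∪ S)) y v) (hv : v ∈ G.ancSet ({x, y} ∪ S)) :
    G.Inducing S x y :=
  .inr (hy.exists_meet hx hv)

theorem ColliderChain.inducing_of_end (hG : G.WF) {S : Set N} {x y : N}
    (h : G.ColliderChain (G.ancSet ({x, y} ∪ S)) x y) : G.Inducing S x y := by
  cases h with
  | single h => exact .inl (adj_symm hG (adj_of_mark h))
  | step h hw hb => exact .inr ⟨_, hw, h, hb.1⟩

theorem Inducing.symm (hG : G.WF) {S : Set N} {x y : N} (h : G.Inducing S x y) :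
    G.Inducing S y x := by
  rcases h with h | ⟨v, hv, hc, hm⟩
  · exact .inl (adj_symm hG h)
  · rw [Set.pair_comm] at hv hc
    exact ColliderChain.inducing (.single hm) hc hv

theorem ColliderChain.exists_seq (hG : G.WF) {X : Set N} {x v : N} (h : G.ColliderChain X x v) :
    ∃ (n : ℕ) (f : ℕ → N), f 0 = x ∧ f (n + 1) = v ∧ (∀ i < n + 1, G.adj (f i) (f (i + 1))) ∧
      (∀ i, 0 < i → i < n + 1 →
        (f i ∈ X ∧ G.mark (f i) (f (i - 1)) = some Mark.arrow) ∧
        (f i ∈ X ∧ G.mark (f i) (f (i + 1)) = some Mark.arrow)) ∧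
      G.mark v (f n) = some Mark.arrow := by
  induction h with
  | @single v h =>
    refine ⟨0, fun k => if k = 0 then x else v, by simp, by simp, ?_, ?_, by simpa using h⟩
    · intro i hi
      obtain rfl : i = 0 := by omega
      simpa using adj_symm hG (adj_of_mark h)
    · intro i h0 h1; omega
  | @step w v _ hw hb ih =>
    obtain ⟨n, f, h0, hn, hE, hB, hl⟩ := ih
    refine ⟨n + 1, fun k => if k ≤ n + 1 then f k else v, by simpa using h0, by simp,
      ?_, ?_, by simpa [hn] using hb.2⟩
    · intro i hi
      rcases (Nat.lt_succ_iff.1 hi).eq_or_lt with rfl | h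
      · simpa [hn] using adj_of_mark hb.1
      · simpa [h.le, Nat.succ_le_of_lt h] using hE i h
    · intro i hi0 hi
      rcases (Nat.lt_succ_iff.1 hi).eq_or_lt with rfl | h
      · simpa [hn] using ⟨⟨hw, hl⟩, hw, hb.1⟩
      · have := hB i hi0 h
        simpa [h.le, Nat.succ_le_of_lt h, show i - 1 ≤ n + 1 by omega] using this

theorem Inducing.inducingPathBtw (hG : G.WF) {S : Set N} {x y : N} (h : G.Inducing S x y) :
    G.InducingPathBtw ∅ S x y := by
  have key : ∃ (n : ℕ) (f : ℕ → N), f 0 = x ∧ f n = y ∧ (∀ i < n, G.adj (f i) (f (i + 1))) ∧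
      ∀ i, 0 < i → i < n →
        (f i ∈ G.ancSet ({x, y} ∪ S) ∧ G.mark (f i) (f (i - 1)) = some Mark.arrow) ∧
        (f i ∈ G.ancSet ({x, y} ∪ S) ∧ G.mark (f i) (f (i + 1)) = some Mark.arrow) := by
    rcases h with h | ⟨v, hv, hc, hm⟩
    · refine ⟨1, fun k => if k = 0 then x else y, by simp, by simp, ?_, ?_⟩
      · intro i hi
        obtain rfl : i = 0 := by omega
        simpa using h
      · intro i h0 h1; omega
    · obtain ⟨n, f, h0, hn, hE, hB, hl⟩ := hc.exists_seq hG
      refine ⟨n + 2, fun k => if k ≤ n + 1 then f k else y, by simpa using h0, by simp,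
        ?_, ?_⟩
      · intro i hi
        rcases (Nat.lt_succ_iff.1 hi).eq_or_lt with rfl | h
        · simpa [hn] using adj_of_mark hm
        · simpa [h.le, Nat.succ_le_of_lt h] using hE i h
      · intro i hi0 hi
        rcases (Nat.lt_succ_iff.1 hi).eq_or_lt with rfl | h
        · simpa [hn] using ⟨⟨hv, hl⟩, hv, hm⟩
        · have := hB i hi0 h
          simpa [h.le, Nat.succ_le_of_lt h, show i - 1 ≤ n + 1 by omega] using this
  obtain ⟨n, f, h0, hn, hE, hB⟩ := key
  obtain ⟨n, f, h0, hn, hE, hB, hinj⟩ := exists_injective_seq h0 hn hE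
    (B := fun p q => p ∈ G.ancSet ({x, y} ∪ S) ∧ G.mark p q = some Mark.arrow) hB
  refine ⟨⟨n, f, hE⟩, hinj, h0, hn, fun i hi0 hi => .inr ?_, fun i hi0 hi _ => ?_⟩
  · exact ⟨(hB i hi0 hi).1.2, (hB i hi0 hi).2.2⟩
  · simpa [GWalk.first, GWalk.last, h0, hn] using (hB i hi0 hi).1.1

theorem InducingPathBtw.inducing {S : Set N} {x y : N} (hne : x ≠ y)
    (h : G.InducingPathBtw ∅ S x y) : G.Inducing S x y := by
  obtain ⟨w, -, hx, hy, hc, ha⟩ := h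
  rw [hx, hy] at ha
  simp only [GWalk.first] at hx
  simp only [GWalk.last] at hy
  have hcol : ∀ i, 0 < i → i < w.len → w.ColliderAt i := fun i h0 h1 => by
    simpa using hc i h0 h1
  have hchain : ∀ i, 0 < i → i < w.len →
      G.ColliderChain (G.ancSet ({x, y} ∪ S)) x (w.f i) := by
    intro i h0
    induction i, h0 using Nat.le_induction with
    | base =>
      intro h1
      have := (hcol 1 one_pos h1).1
      exact .single (by simpa [hx] using this)
    | succ i h0 ih =>
      intro h1
      refine .step (ih (by omega)) (ha i h0 (by omega) (hcol i h0 (by omega))) ⟨?_, ?_⟩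
      · exact (hcol i h0 (by omega)).2
      · exact (hcol (i + 1) (by omega) h1).1
  rcases Nat.lt_trichotomy w.len 1 with h | h | h
  · obtain h : w.len = 0 := by omega
    rw [h] at hy
    exact absurd (hx.symm.trans hy) hne
  · left
    have := w.hadj 0 (by omega)
    rw [hx] at this
    rw [h] at hy
    simpa [hy] using this
  · refine .inr ⟨w.f (w.len - 1), ha _ (by omega) (by omega) (hcol _ (by omega) (by omega)),
      hchain _ (by omega) (by omega), ?_⟩
    have := (hcol (w.len - 1) (by omega) (by omega)).2
    rwa [Nat.sub_add_cancel (by omega), hy] at this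

theorem inducingPathBtw_iff {S : Set N} {x y : N} (hne : x ≠ y) (hG : G.WF) :
    G.InducingPathBtw ∅ S x y ↔ G.Inducing S x y :=
  ⟨InducingPathBtw.inducing hne, Inducing.inducingPathBtw hG⟩

end MixedGraph

namespace MixedGraph

variable {N : Type} {G : MixedGraph N}

namespace IsIADMG

theorem not_dir_of_anc (hG : G.IsIADMG) {x y : N} (h : G.anc y x) : ¬ G.dir x y :=
  fun hd => hG.2.2.1 x y hd h

theorem anc_antisymm (hG : G.IsIADMG) {x y : N} (hxy : G.anc x y) (hyx : G.anc y x) :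
    x = y := by
  rcases Relation.ReflTransGen.cases_head hxy with h | ⟨z, hxz, hzy⟩
  · exact h
  · exact absurd hxz (hG.not_dir_of_anc (hzy.trans hyx))

theorem dir_or_arrow (hG : G.IsIADMG) {x y : N} (h : G.adj x y) :
    G.dir x y ∨ G.mark x y = some Mark.arrow := by
  rcases hG.2.1 x y h with h | h | h
  · exact .inl h
  · exact .inr h.2
  · exact .inr h.1

theorem dir_or_bidir_of_arrow (hG : G.IsIADMG) {x y : N} (h : G.mark x y = some Mark.arrow) :
    G.dir y x ∨ G.bidir x y := by
  rcases hG.dir_or_arrow (adj_symm hG.1 (adj_of_mark h)) with h' | h'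
  · exact .inl h'
  · exact .inr ⟨h, h'⟩

theorem not_dir_of_mem_ancSet (hG : G.IsIADMG) {S : Set N} {u c v : N}
    (hu : u ∉ G.ancSet ({c} ∪ S)) (hv : v ∈ G.ancSet ({c, u} ∪ S)) : ¬ G.dir u v := by
  intro hd
  obtain ⟨s, hs, hvs⟩ := hv
  rcases hs with (rfl | rfl) | hs
  · exact hu ⟨s, .inl rfl, Relation.ReflTransGen.head hd hvs⟩
  · exact hG.not_dir_of_anc hvs hd
  · exact hu ⟨s, .inr hs, Relation.ReflTransGen.head hd hvs⟩

end IsIADMG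

theorem ColliderChain.bidirChain {X : Set N} {u w : N} (h : G.ColliderChain X u w)
    (hu : u ∈ X) (hw : w ∈ X)
    (hb : ∀ z ∈ X, G.mark z u = some Mark.arrow → G.bidir u z) : G.BidirChain X u w := by
  induction h with
  | single h => exact Relation.ReflTransGen.single ⟨hu, hb _ hw h⟩
  | step _ hv hvw ih => exact (ih hv).tail ⟨hv, hvw⟩

end MixedGraph

namespace RepresentsS

open MixedGraph

variable {N : Type} {P : MixedGraph N} {A : SADMG N}

theorem not_mem_ancSet (hR : RepresentsS P A) {x y : N} (h : P.mark x y = some Mark.arrow) :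
    x ∉ A.graph.ancSet ({y} ∪ A.sel) := hR.2.2.2.1 x y h

theorem mem_ancSet (hR : RepresentsS P A) {x y : N} (h : P.mark x y = some Mark.tail) :
    x ∈ A.graph.ancSet ({y} ∪ A.sel) := hR.2.2.2.2 x y h

theorem not_mem_ancSet_sel (hR : RepresentsS P A) {x y : N}
    (h : P.mark x y = some Mark.arrow) : x ∉ A.graph.ancSet A.sel :=
  fun hx => hR.not_mem_ancSet h (ancSet_mono Set.subset_union_right hx)

theorem adj_iff (hR : RepresentsS P A) (hA : A.WF) {x y : N} (hne : x ≠ y) (hx : x ∈ P.nodes)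
    (hy : y ∈ P.nodes) :
    P.adj x y ↔ ¬(x ∈ P.inputs ∧ y ∈ P.inputs) ∧ A.graph.Inducing A.sel x y := by
  rw [hR.2.2.1 x y hne hx hy, inducingPathBtw_iff hne hA.1.1]

theorem inducing (hR : RepresentsS P A) (hP : P.WF) (hA : A.WF) {x y : N} (h : P.adj x y) :
    A.graph.Inducing A.sel x y := by
  have hne : x ≠ y := by
    rintro rfl
    simp [adj, hP.2.2.2.2.1] at h
  obtain ⟨hx, hy⟩ := hP.2.2.2.2.2 x y h
  exact ((hR.adj_iff hA hne hx hy).1 h).2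

theorem colliderChain (hR : RepresentsS P A) (hP : P.WF) (hA : A.WF) {u c : N}
    (h : P.mark u c = some Mark.arrow) :
    A.graph.ColliderChain (A.graph.ancSet ({c, u} ∪ A.sel)) c u := by
  have hu := hR.not_mem_ancSet h
  rcases hR.inducing hP hA (adj_symm hP (adj_of_mark h)) with hadj | ⟨v, hv, hc, hm⟩
  · rcases hA.1.dir_or_arrow (adj_symm hA.1.1 hadj) with h' | h'
    · exact absurd ⟨c, .inl rfl, Relation.ReflTransGen.single h'⟩ hu
    · exact .single h'
  · rcases hA.1.dir_or_bidir_of_arrow hm with h' | h'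
    · exact absurd h' (hA.1.not_dir_of_mem_ancSet hu hv)
    · exact .step hc hv h'

theorem bidirChain (hR : RepresentsS P A) (hP : P.WF) (hA : A.WF) {u v : N}
    (h : P.bidir u v) :
    A.graph.BidirChain (A.graph.ancSet ({u, v} ∪ A.sel)) u v := by
  refine (hR.colliderChain hP hA h.2).bidirChain (mem_ancSet_self (by simp))
    (mem_ancSet_self (by simp)) fun z hz hm => ?_
  rcases hA.1.dir_or_bidir_of_arrow hm with h' | h'
  · rw [Set.pair_comm] at hz
    exact absurd h' (hA.1.not_dir_of_mem_ancSet (hR.not_mem_ancSet h.1) hz)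
  · exact bidir_symm h'

theorem mem_ancSet_of_anc (hR : RepresentsS P A) {x y : N} (h : P.anc x y) :
    x ∈ A.graph.ancSet ({y} ∪ A.sel) := by
  induction h using Relation.ReflTransGen.head_induction_on with
  | refl => exact mem_ancSet_self (by simp)
  | head hd _ ih =>
    refine ancSet_subset_ancSet ?_ (hR.mem_ancSet hd.1)
    rintro s (rfl | hs)
    · exact ih
    · exact mem_ancSet_self (.inr hs)

theorem anc_of_anc (hR : RepresentsS P A) {x y : N} (h : P.anc x y)
    (hx : x ∉ A.graph.ancSet A.sel) : A.graph.anc x y := by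
  obtain ⟨s, rfl | hs, hxs⟩ := hR.mem_ancSet_of_anc h
  · exact hxs
  · exact absurd ⟨s, hs, hxs⟩ hx

theorem colliderChain_of_colliderChain (hR : RepresentsS P A) (hP : P.WF) (hA : A.WF)
    {X Y : Set N} {x v : N} (hc : P.ColliderChain X x v)
    (hX : X ⊆ A.graph.ancSet Y) (hx : x ∈ Y) (hY : A.sel ⊆ Y) (hv : v ∈ A.graph.ancSet Y) :
    A.graph.ColliderChain (A.graph.ancSet Y) x v := by
  have hsub : ∀ p q, p ∈ A.graph.ancSet Y → q ∈ A.graph.ancSet Y →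
      A.graph.ancSet ({p, q} ∪ A.sel) ⊆ A.graph.ancSet Y := by
    intro p q hp hq
    refine ancSet_subset_ancSet ?_
    rintro s ((rfl | rfl) | hs)
    · exact hp
    · exact hq
    · exact mem_ancSet_self (hY hs)
  induction hc with
  | single h =>
    exact (hR.colliderChain hP hA h).mono (hsub _ _ (mem_ancSet_self hx) hv)
  | step _ hw hb ih =>
    exact (ih (hX hw)).trans ((hR.bidirChain hP hA hb).mono (hsub _ _ (hX hw) hv))

/-- An inducing walk in a graph representing `A` yields one in `A` with the same endpoints. -/
theorem inducing_of_inducing (hR : RepresentsS P A) (hP : P.WF) (hA : A.WF) {x y : N}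
    (h : P.Inducing ∅ x y) : A.graph.Inducing A.sel x y := by
  rcases h with h | ⟨v, hv, hc, hm⟩
  · exact hR.inducing hP hA h
  · have hX : P.ancSet ({x, y} ∪ ∅) ⊆ A.graph.ancSet ({x, y} ∪ A.sel) := by
      rintro p ⟨s, hs, hps⟩
      rw [Set.union_empty] at hs
      exact ancSet_mono (Set.union_subset_union_left _ (by simpa using hs))
        (hR.mem_ancSet_of_anc hps)
    refine (hR.colliderChain_of_colliderChain hP hA hc hX (by simp)
      Set.subset_union_right (hX hv)).inducing ?_ (hX hv)
    exact hR.colliderChain_of_colliderChain hP hA (ColliderChain.single (X := ∅) hm)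
      (by simp) (by simp) Set.subset_union_right (hX hv)

end RepresentsS

namespace SADMG

open MixedGraph

variable {N : Type} {A : SADMG N}

/-- The maximal ancestral graph of an isADMG. -/
def mag (A : SADMG N) : MixedGraph N where
  inputs := A.graph.inputs
  outputs := A.obs
  mark := fun x y =>
    if x ≠ y ∧ x ∈ A.graph.inputs ∪ A.obs ∧ y ∈ A.graph.inputs ∪ A.obs ∧
        ¬(x ∈ A.graph.inputs ∧ y ∈ A.graph.inputs) ∧ A.graph.Inducing A.sel x y then
      (if x ∈ A.graph.ancSet ({y} ∪ A.sel) then some Mark.tail else some Mark.arrow)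
    else none

theorem mag_adj {x y : N} :
    A.mag.adj x y ↔ x ≠ y ∧ x ∈ A.graph.inputs ∪ A.obs ∧ y ∈ A.graph.inputs ∪ A.obs ∧
      ¬(x ∈ A.graph.inputs ∧ y ∈ A.graph.inputs) ∧ A.graph.Inducing A.sel x y := by
  simp only [adj, mag]
  split_ifs with h1 h2
  · simpa using h1
  · simpa using h1
  · simpa using h1

theorem mag_representsS (hA : A.WF) : RepresentsS A.mag A := by
  refine ⟨rfl, rfl, fun x y hne hx hy => ?_, fun x y h => ?_, fun x y h => ?_⟩
  · rw [mag_adj, inducingPathBtw_iff hne hA.1.1]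
    exact ⟨fun h => h.2.2.2, fun h => ⟨hne, hx, hy, h⟩⟩
  · simp only [mag] at h
    split_ifs at h with h1 h2
    · simp at h
    · exact h2
  · simp only [mag] at h
    split_ifs at h with h1 h2
    · exact h2
    · simp at h

theorem mag_wf (hA : A.WF) : A.mag.WF := by
  obtain ⟨h1, h2, h3, -⟩ := hA.1.1
  refine ⟨h1.mono_right Set.sdiff_subset, h2, h3.subset Set.sdiff_subset, fun x y h => ?_,
    fun x => by simp [mag], fun x y h => ?_⟩
  · obtain ⟨hne, hx, hy, hI, hind⟩ := mag_adj.1 h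
    exact mag_adj.2 ⟨hne.symm, hy, hx, fun h => hI h.symm, hind.symm hA.1.1⟩
  · obtain ⟨hne, hx, hy, -⟩ := mag_adj.1 h
    exact ⟨hx, hy⟩

theorem mag_mark_ne_arrow (hA : A.WF) {i : N} (hi : i ∈ A.graph.inputs) (y : N) :
    A.mag.mark i y ≠ some Mark.arrow := by
  intro h
  obtain ⟨z, hz⟩ := ((mag_representsS hA).colliderChain (mag_wf hA) hA h).arrowAt
  exact hA.1.2.2.2.1 i hi z hz

theorem mag_isIMAG (hA : A.WF) : A.mag.IsIMAG := by
  have hR := mag_representsS hA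
  have hW := mag_wf hA
  refine ⟨⟨hW, fun i hi y => mag_mark_ne_arrow hA hi y, fun i hi j hj h => ?_,
    fun x y hd hyx => ?_, fun x y hxy hb => ?_, fun x y z hm hu => ?_,
    fun x y hne hx hy hadj hind => ?_⟩, fun x y => ?_⟩
  · exact (mag_adj.1 h).2.2.2.1 ⟨hi, hj⟩
  · have hy := hR.not_mem_ancSet_sel hd.2
    exact hR.not_mem_ancSet hd.2 ⟨x, .inl rfl, hR.anc_of_anc hyx hy⟩
  · have hx := hR.not_mem_ancSet_sel hb.2
    exact hR.not_mem_ancSet hb.2 ⟨y, .inl rfl, hR.anc_of_anc hxy hx⟩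
  · have hy := hR.not_mem_ancSet_sel hm
    obtain ⟨s, rfl | hs, hys⟩ := hR.mem_ancSet hu.1
    · obtain ⟨t, rfl | ht, hzt⟩ := hR.mem_ancSet hu.2
      · exact (mag_adj.1 (adj_of_mark hu.1)).1 (hA.1.anc_antisymm hys hzt)
      · exact hy ⟨t, ht, hys.trans hzt⟩
    · exact hy ⟨s, hs, hys⟩
  · replace hind := InducingPathBtw.inducing hne hind
    by_cases hI : x ∈ A.mag.inputs ∧ y ∈ A.mag.inputs
    · rcases hind with h | ⟨v, ⟨s, hs, hvs⟩, hc, hm⟩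
      · exact hadj h
      · have hs' : s ∈ A.graph.inputs := by
          rcases hs with (rfl | rfl) | hs
          · exact hI.1
          · exact hI.2
          · exact hs.elim
        rcases Relation.ReflTransGen.cases_tail hvs with h | ⟨t, -, ht⟩
        · subst h
          exact mag_mark_ne_arrow hA hs' _ hm
        · exact mag_mark_ne_arrow hA hs' _ ht.2
    · exact hadj ((hR.adj_iff hA hne hx hy).2 ⟨hI, hR.inducing_of_inducing hW hA hind⟩)
  · simp only [mag]
    split_ifs <;> simp

end SADMG

namespace MixedGraph

variable {N : Type} {G : MixedGraph N}

theorem admgSoftManip_not_dir_inr {D : Set N} {z : N ⊕ N} {d : N} :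
    ¬ (admgSoftManip G D).dir z (Sum.inr d) := by
  rcases z with z | z <;> simp [dir, admgSoftManip]

theorem admgSoftManip_anc_inr {D : Set N} {z : N ⊕ N} {d : N}
    (h : (admgSoftManip G D).anc z (Sum.inr d)) : z = Sum.inr d := by
  rcases Relation.ReflTransGen.cases_tail h with h | ⟨t, -, ht⟩
  · exact h.symm
  · exact absurd ht admgSoftManip_not_dir_inr

theorem admgSoftManip_anc_inl {D : Set N} {x y : N} :
    (admgSoftManip G D).anc (Sum.inl x) (Sum.inl y) ↔ G.anc x y := by
  constructor
  · intro h
    obtain ⟨z, rfl⟩ : ∃ z : N ⊕ N, z = Sum.inl y := ⟨_, rfl⟩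
    have key : ∀ z, (admgSoftManip G D).anc (Sum.inl x) z → ∃ y, z = Sum.inl y ∧ G.anc x y := by
      intro z hz
      induction hz with
      | refl => exact ⟨x, rfl, .refl⟩
      | @tail p q _ hpq ih =>
        obtain ⟨p, rfl, hp⟩ := ih
        rcases q with q | q
        · exact ⟨q, rfl, hp.tail hpq⟩
        · exact absurd hpq admgSoftManip_not_dir_inr
    obtain ⟨y', hy, hxy⟩ := key _ h
    rwa [Sum.inl_injective hy]
  · exact fun h => Relation.ReflTransGen.lift (r := G.dir) Sum.inl (fun _ _ h => h) _ _ h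

theorem inl_mem_ancSet_admgSoftManip {D : Set N} {a x : N} {S : Set N} :
    Sum.inl x ∈ (admgSoftManip G D).ancSet ({Sum.inr a} ∪ Sum.inl '' S) ↔
      x ∈ G.ancSet S := by
  constructor
  · rintro ⟨s, rfl | ⟨s, hs, rfl⟩, hxs⟩
    · cases admgSoftManip_anc_inr hxs
    · exact ⟨s, hs, admgSoftManip_anc_inl.1 hxs⟩
  · rintro ⟨s, hs, hxs⟩
    exact ⟨Sum.inl s, .inr ⟨s, hs, rfl⟩, admgSoftManip_anc_inl.2 hxs⟩

theorem inl_mem_ancSet_admgSoftManip_pair {D : Set N} {a b x : N} {S : Set N} :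
    Sum.inl x ∈ (admgSoftManip G D).ancSet ({Sum.inr a, Sum.inl b} ∪ Sum.inl '' S) ↔
      x ∈ G.ancSet ({b} ∪ S) := by
  rw [← inl_mem_ancSet_admgSoftManip (D := D) (a := a)]
  rw [Set.image_union, Set.image_singleton, ← Set.union_assoc, Set.insert_eq]

theorem IsIADMG.admgSoftManip (hG : G.IsIADMG) {a : N} (ha : a ∈ G.outputs) :
    (admgSoftManip G {a}).IsIADMG := by
  obtain ⟨⟨h1, h2, h3, h4, h5, h6⟩, h7, h8, h9, h10⟩ := hG
  refine ⟨⟨?_, ?_, ?_, ?_, ?_, ?_⟩, ?_, ?_, ?_, ?_⟩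
  · rw [Set.disjoint_left] at h1 ⊢
    rintro z (⟨x, hx, rfl⟩ | ⟨x, hx, rfl⟩) ⟨y, hy, hxy⟩
    · exact h1 hx (Sum.inl_injective hxy ▸ hy)
    · cases hxy
  · exact (h2.image _).union ((Set.finite_singleton a).image _)
  · exact h3.image _
  · rintro (x | x) (y | y) h
    · exact h4 x y h
    · simp only [_root_.admgSoftManip] at h ⊢
      split_ifs at h ⊢ <;> simp_all
    · simp only [_root_.admgSoftManip] at h ⊢
      split_ifs at h ⊢ <;> simp_all
    · simp [_root_.admgSoftManip] at h
  · rintro (x | x)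
    · exact h5 x
    · rfl
  · have hin : ∀ x, x ∈ G.nodes → Sum.inl x ∈ (_root_.admgSoftManip G {a}).nodes := by
      rintro x (hx | hx)
      · exact .inl (.inl ⟨x, hx, rfl⟩)
      · exact .inr ⟨x, hx, rfl⟩
    have hout : Sum.inr a ∈ (_root_.admgSoftManip G {a}).nodes := .inl (.inr ⟨a, rfl, rfl⟩)
    rintro (x | x) (y | y) h
    · exact ⟨hin x (h6 x y h).1, hin y (h6 x y h).2⟩
    · simp only [_root_.admgSoftManip, Set.mem_singleton_iff] at h
      split_ifs at h with h'
      · obtain ⟨rfl, rfl⟩ := h'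
        exact ⟨hin _ (.inr ha), hout⟩
      · simp at h
    · simp only [_root_.admgSoftManip, Set.mem_singleton_iff] at h
      split_ifs at h with h'
      · obtain ⟨rfl, rfl⟩ := h'
        exact ⟨hout, hin _ (.inr ha)⟩
      · simp at h
    · simp [_root_.admgSoftManip] at h
  · rintro (x | x) (y | y) h
    · exact h7 x y h
    · right; left
      simp only [adj, dir, _root_.admgSoftManip] at h ⊢
      split_ifs at h ⊢ <;> simp_all
    · left
      simp only [adj, dir, _root_.admgSoftManip] at h ⊢
      split_ifs at h ⊢ <;> simp_all
    · simp [adj, _root_.admgSoftManip] at h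
  · rintro (x | x) (y | y) h hyx
    · exact h8 x y h (admgSoftManip_anc_inl.1 hyx)
    · exact admgSoftManip_not_dir_inr h
    · cases admgSoftManip_anc_inr hyx
    · exact admgSoftManip_not_dir_inr h
  · rintro z (⟨x, hx, rfl⟩ | ⟨x, hx, rfl⟩) (y | y)
    · exact h9 x hx y
    · simp only [_root_.admgSoftManip, Set.mem_singleton_iff]
      split_ifs with h
      · obtain ⟨rfl, rfl⟩ := h
        exact absurd ha (Set.disjoint_left.1 h1 hx)
      · simp
    · simp only [_root_.admgSoftManip]
      split_ifs <;> simp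
    · simp [_root_.admgSoftManip]
  · rintro z (⟨x, hx, rfl⟩ | ⟨x, hx, rfl⟩) w (⟨y, hy, rfl⟩ | ⟨y, hy, rfl⟩)
    · exact h10 x hx y hy
    · simp only [adj, _root_.admgSoftManip, Set.mem_singleton_iff]
      split_ifs with h
      · obtain ⟨rfl, rfl⟩ := h
        exact absurd ha (Set.disjoint_left.1 h1 hx)
      · simp
    · simp only [adj, _root_.admgSoftManip, Set.mem_singleton_iff]
      split_ifs with h
      · obtain ⟨rfl, rfl⟩ := h
        exact absurd ha (Set.disjoint_left.1 h1 hy)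
      · simp
    · simp [adj, _root_.admgSoftManip]

end MixedGraph

namespace SADMG

open MixedGraph

variable {N : Type} {A : SADMG N}

theorem WF.softManip (hA : A.WF) {a : N} (ha : a ∈ A.graph.outputs) :
    (A.softManip {a}).WF :=
  ⟨hA.1.admgSoftManip ha, Set.image_mono hA.2⟩

/-- The condition on `A` under which `I_a` and `b` become adjacent. -/
def RegimeAdj (A : SADMG N) (a b : N) : Prop :=
  a ∈ A.graph.ancSet ({b} ∪ A.sel) ∧ ∃ v ∈ A.graph.ancSet ({b} ∪ A.sel),
    A.graph.BidirChain (A.graph.ancSet ({b} ∪ A.sel)) a v ∧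
    A.graph.mark v b = some Mark.arrow

theorem softManip_inducing_iff {a b : N} (hne : b ≠ a) :
    (A.softManip {a}).graph.Inducing (A.softManip {a}).sel (Sum.inr a) (Sum.inl b) ↔
      A.RegimeAdj a b := by
  simp only [SADMG.softManip]
  constructor
  · rintro (h | ⟨v, hv, hc, hm⟩)
    · simp [adj, admgSoftManip, hne] at h
    · have key : ∀ w, (admgSoftManip A.graph {a}).ColliderChain
          ((admgSoftManip A.graph {a}).ancSet
            ({Sum.inr a, Sum.inl b} ∪ Sum.inl '' A.sel)) (Sum.inr a) w →
          ∃ w', w = Sum.inl w' ∧ A.graph.BidirChain (A.graph.ancSet ({b} ∪ A.sel)) a w' := by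
        intro w hw
        induction hw with
        | @single w h =>
          rcases w with w | w
          · refine ⟨w, rfl, ?_⟩
            simp only [admgSoftManip] at h
            split_ifs at h with h'
            rw [h'.2]
            exact .refl
          · simp [admgSoftManip] at h
        | @step p w _ hp hpw ih =>
          obtain ⟨p, rfl, hap⟩ := ih
          rcases w with w | w
          · exact ⟨w, rfl, hap.tail ⟨inl_mem_ancSet_admgSoftManip_pair.1 hp, hpw⟩⟩
          · have := hpw.2
            simp only [admgSoftManip] at this
            split_ifs at this
            simp at this
      obtain ⟨v, rfl, hav⟩ := key v hc
      have hv' := inl_mem_ancSet_admgSoftManip_pair.1 hv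
      refine ⟨?_, v, hv', hav, hm⟩
      rcases Relation.ReflTransGen.cases_head hav with rfl | ⟨t, ht, -⟩
      · exact hv'
      · exact ht.1
  · rintro ⟨ha, v, hv, hav, hm⟩
    refine .inr ⟨Sum.inl v, inl_mem_ancSet_admgSoftManip_pair.2 hv, ?_, hm⟩
    refine ColliderChain.trans (u := Sum.inl a) (.single (by simp [admgSoftManip])) ?_
    exact Relation.ReflTransGen.lift Sum.inl
      (fun p q h => ⟨inl_mem_ancSet_admgSoftManip_pair.2 h.1, h.2⟩) _ _ hav

end SADMG

namespace MixedGraph.IsIMAG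

variable {N : Type} {M : MixedGraph N}

theorem tail_or_arrow (hM : M.IsIMAG) {x y : N} (h : M.adj x y) :
    M.mark x y = some Mark.tail ∨ M.mark x y = some Mark.arrow := by
  have hc := hM.2 x y
  obtain ⟨m, hm⟩ := Option.isSome_iff_exists.1 h
  cases m with
  | tail => exact .inl hm
  | arrow => exact .inr hm
  | circle => exact absurd hm hc

theorem wf (hM : M.IsIMAG) : M.WF := hM.1.1

end MixedGraph.IsIMAG

namespace RepresentsS

open MixedGraph

variable {N : Type} {M : MixedGraph N} {A : SADMG N} {M' : MixedGraph (N ⊕ N)} {a b : N}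

theorem softManip_adj_iff (hA : A.WF) (ha : a ∈ A.graph.outputs) (hb : b ∈ A.obs)
    (hne : b ≠ a) (hR : RepresentsS M' (A.softManip {a})) :
    M'.adj (Sum.inr a) (Sum.inl b) ↔ A.RegimeAdj a b := by
  have hb' : Sum.inl b ∈ M'.outputs := by
    rw [hR.2.1]
    refine ⟨⟨b, hb.1, rfl⟩, ?_⟩
    rintro ⟨x, hx, hxb⟩
    exact hb.2 (Sum.inl_injective hxb ▸ hx)
  have ha' : Sum.inr a ∈ M'.inputs := by
    rw [hR.1]
    exact .inr ⟨a, rfl, rfl⟩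
  have hb'' : Sum.inl b ∉ M'.inputs := by
    rw [hR.1]
    rintro (⟨x, hx, hxb⟩ | ⟨x, hx, hxb⟩)
    · exact Set.disjoint_left.1 hA.1.1.1 hx (Sum.inl_injective hxb ▸ hb.1)
    · cases hxb
  rw [hR.adj_iff (hA.softManip ha) (by simp) (.inl ha') (.inr hb'),
    SADMG.softManip_inducing_iff hne]
  simp [hb'']

theorem softManip_mark_left (hA : A.WF) (ha : a ∈ A.graph.outputs) (hb : b ∈ A.obs)
    (hne : b ≠ a) (hM' : M'.IsIMAG) (hR : RepresentsS M' (A.softManip {a}))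
    (h : A.RegimeAdj a b) : M'.mark (Sum.inr a) (Sum.inl b) = some Mark.tail := by
  refine (hM'.tail_or_arrow ((hR.softManip_adj_iff hA ha hb hne).2 h)).resolve_right ?_
  refine hM'.1.2.1 _ ?_ _
  rw [hR.1]
  exact .inr ⟨a, rfl, rfl⟩

theorem softManip_mem_ancSet (hR : RepresentsS M' (A.softManip {a}))
    (h : M'.mark (Sum.inl b) (Sum.inr a) = some Mark.tail) : b ∈ A.graph.ancSet A.sel :=
  inl_mem_ancSet_admgSoftManip.1 (hR.mem_ancSet h)

theorem softManip_not_mem_ancSet (hR : RepresentsS M' (A.softManip {a}))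
    (h : M'.mark (Sum.inl b) (Sum.inr a) = some Mark.arrow) : b ∉ A.graph.ancSet A.sel :=
  fun hb => hR.not_mem_ancSet h (inl_mem_ancSet_admgSoftManip.2 hb)

theorem softManip_dir_iff (hA : A.WF) (ha : a ∈ A.graph.outputs) (hb : b ∈ A.obs)
    (hne : b ≠ a) (hM' : M'.IsIMAG) (hR : RepresentsS M' (A.softManip {a})) :
    M'.dir (Sum.inr a) (Sum.inl b) ↔ A.RegimeAdj a b ∧ b ∉ A.graph.ancSet A.sel := by
  constructor
  · exact fun h => ⟨(hR.softManip_adj_iff hA ha hb hne).1 (adj_of_mark h.1),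
      hR.softManip_not_mem_ancSet h.2⟩
  · rintro ⟨h, hbS⟩
    refine ⟨hR.softManip_mark_left hA ha hb hne hM' h, ?_⟩
    refine (hM'.tail_or_arrow (adj_symm hM'.wf
      ((hR.softManip_adj_iff hA ha hb hne).2 h))).resolve_left ?_
    exact fun ht => hbS (hR.softManip_mem_ancSet ht)

theorem softManip_undir_iff (hA : A.WF) (ha : a ∈ A.graph.outputs) (hb : b ∈ A.obs)
    (hne : b ≠ a) (hM' : M'.IsIMAG) (hR : RepresentsS M' (A.softManip {a})) :
    M'.undir (Sum.inr a) (Sum.inl b) ↔ A.RegimeAdj a b ∧ b ∈ A.graph.ancSet A.sel := by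
  constructor
  · exact fun h => ⟨(hR.softManip_adj_iff hA ha hb hne).1 (adj_of_mark h.1),
      hR.softManip_mem_ancSet h.2⟩
  · rintro ⟨h, hbS⟩
    refine ⟨hR.softManip_mark_left hA ha hb hne hM' h, ?_⟩
    refine (hM'.tail_or_arrow (adj_symm hM'.wf
      ((hR.softManip_adj_iff hA ha hb hne).2 h))).resolve_right ?_
    exact fun ht => hR.softManip_not_mem_ancSet ht hbS

theorem adj_of_regimeAdj (hM : M.IsIMAG) (hA : A.WF) (hR : RepresentsS M A)
    (ha : a ∈ M.outputs) (hb : b ∈ M.outputs) (hne : b ≠ a) (h : A.RegimeAdj a b) :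
    M.adj a b := by
  obtain ⟨-, v, hv, hav, hm⟩ := h
  refine (hR.adj_iff hA hne.symm (.inr ha) (.inr hb)).2
    ⟨fun h => Set.disjoint_left.1 hM.wf.1 h.2 hb, ?_⟩
  have hsub : A.graph.ancSet ({b} ∪ A.sel) ⊆ A.graph.ancSet ({a, b} ∪ A.sel) :=
    ancSet_mono (Set.union_subset_union_left _ (by simp))
  rcases (hav.mono hsub).eq_or_colliderChain with rfl | hc
  · exact .inl (adj_of_mark hm)
  · exact .inr ⟨v, hsub hv, hc, hm⟩

theorem undir_of_regimeAdj (hM : M.IsIMAG) (hA : A.WF) (hR : RepresentsS M A)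
    (ha : a ∈ M.outputs) (hb : b ∈ M.outputs) (hne : b ≠ a) (h : A.RegimeAdj a b)
    (hbS : b ∈ A.graph.ancSet A.sel) : M.undir a b := by
  have hadj := hR.adj_of_regimeAdj hM hA ha hb hne h
  exact ⟨(hM.tail_or_arrow hadj).resolve_right fun h' => hR.not_mem_ancSet h' h.1,
    (hM.tail_or_arrow (adj_symm hM.wf hadj)).resolve_right fun h' =>
      hR.not_mem_ancSet_sel h' hbS⟩

theorem dir_of_regimeAdj (hM : M.IsIMAG) (hA : A.WF) (hR : RepresentsS M A)
    (ha : a ∈ M.outputs) (hb : b ∈ M.outputs) (hne : b ≠ a) (h : A.RegimeAdj a b)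
    (hbS : b ∉ A.graph.ancSet A.sel) : M.dir a b := by
  have hadj := hR.adj_of_regimeAdj hM hA ha hb hne h
  refine ⟨(hM.tail_or_arrow hadj).resolve_right fun h' => hR.not_mem_ancSet h' h.1,
    (hM.tail_or_arrow (adj_symm hM.wf hadj)).resolve_left fun h' => ?_⟩
  obtain ⟨s, rfl | hs, hbs⟩ := hR.mem_ancSet h'
  · obtain ⟨t, rfl | ht, hst⟩ := h.1
    · exact hne (hA.1.anc_antisymm hbs hst)
    · exact hbS ⟨t, ht, hbs.trans hst⟩
  · exact hbS ⟨s, hs, hbs⟩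

theorem not_visibleCond_of_regimeAdj (hM : M.IsIMAG) (hA : A.WF) (hR : RepresentsS M A)
    (ha : a ∈ M.outputs) (hb : b ∈ M.outputs) (h : A.RegimeAdj a b) :
    ¬ M.VisibleCond a b := by
  rintro (haI | ⟨c, hcb, hnadj, hvis⟩)
  · exact Set.disjoint_left.1 hM.wf.1 haI ha
  have hsub : A.graph.ancSet ({b} ∪ A.sel) ⊆ A.graph.ancSet ({c, b} ∪ A.sel) :=
    ancSet_mono (Set.union_subset_union_left _ (by simp))
  have hpair : ∀ p q, p ∈ A.graph.ancSet ({c, b} ∪ A.sel) →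
      q ∈ A.graph.ancSet ({c, b} ∪ A.sel) →
      A.graph.ancSet ({p, q} ∪ A.sel) ⊆ A.graph.ancSet ({c, b} ∪ A.sel) := by
    intro p q hp hq
    refine ancSet_subset_ancSet ?_
    rintro s ((rfl | rfl) | hs)
    · exact hp
    · exact hq
    · exact mem_ancSet_self (.inr hs)
  have hc : c ∈ A.graph.ancSet ({c, b} ∪ A.sel) := mem_ancSet_self (by simp)
  obtain ⟨haX, v, hv, hav, hm⟩ := h
  suffices hca : c ∈ M.nodes ∧ A.graph.ColliderChain (A.graph.ancSet ({c, b} ∪ A.sel)) c a by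
    refine hnadj ((hR.adj_iff hA hcb hca.1 (.inr hb)).2
      ⟨fun h => Set.disjoint_left.1 hM.wf.1 h.2 hb, ?_⟩)
    exact .inr ⟨v, hsub hv, hca.2.trans (hav.mono hsub), hm⟩
  rcases hvis with hac | ⟨w, -, hlen, hw0, hwl, harr, hbi, hdir⟩
  · exact ⟨(hM.wf.2.2.2.2.2 a c (adj_of_mark hac)).2,
      (hR.colliderChain hM.wf hA hac).mono (hpair _ _ hc (hsub haX))⟩
  · simp only [GWalk.first] at hw0
    simp only [GWalk.last] at hwl
    have hmem : ∀ i, 1 ≤ i → i ≤ w.len → w.f i ∈ A.graph.ancSet ({c, b} ∪ A.sel) := by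
      intro i hi1 hi
      rcases hi.eq_or_lt with rfl | hi
      · rw [hwl]; exact hsub haX
      · exact hsub (hR.mem_ancSet (hdir i hi1 hi).1)
    rw [hw0] at harr
    refine ⟨(hM.wf.2.2.2.2.2 _ c (adj_of_mark harr)).2, ?_⟩
    rw [← hwl]
    have key : ∀ i, 1 ≤ i → i ≤ w.len →
        A.graph.ColliderChain (A.graph.ancSet ({c, b} ∪ A.sel)) c (w.f i) := by
      intro i hi
      induction i, hi using Nat.le_induction with
      | base =>
        intro h1
        exact (hR.colliderChain hM.wf hA harr).mono (hpair _ _ hc (hmem 1 le_rfl h1))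
      | succ i hi ih =>
        intro hi1
        exact (ih (by omega)).trans ((hR.bidirChain hM.wf hA (hbi i hi (by omega))).mono
          (hpair _ _ (hmem i hi (by omega)) (hmem (i + 1) (by omega) hi1)))
    exact key _ (by omega) le_rfl

end RepresentsS

namespace MixedGraph.IsIMAG

variable {N : Type} {M : MixedGraph N} {a b : N}

theorem not_dir_of_anc (hM : M.IsIMAG) {x y : N} (h : M.anc y x) : ¬ M.dir x y :=
  fun hd => hM.1.2.2.2.1 x y hd h

theorem not_bidir_of_anc (hM : M.IsIMAG) {x y : N} (h : M.anc x y) : ¬ M.bidir y x :=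
  hM.1.2.2.2.2.1 x y h

theorem not_undir_of_arrow (hM : M.IsIMAG) {x y z : N} (h : M.mark y x = some Mark.arrow) :
    ¬ M.undir y z := hM.1.2.2.2.2.2.1 x y z h

theorem adj_of_inducing (hM : M.IsIMAG) {x y : N} (hne : x ≠ y) (hx : x ∈ M.nodes)
    (hy : y ∈ M.nodes) (h : M.Inducing ∅ x y) : M.adj x y := by
  by_contra hn
  exact hM.1.2.2.2.2.2.2 x y hne hx hy hn (h.inducingPathBtw hM.wf)

theorem arrow_of_adj_of_dir (hM : M.IsIMAG) {v w : N} (hvb : M.dir v b)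
    (hvw : M.mark v w = some Mark.arrow) (hwb : M.adj w b) : M.mark b w = some Mark.arrow := by
  refine (hM.tail_or_arrow (adj_symm hM.wf hwb)).resolve_left fun ht => ?_
  rcases hM.tail_or_arrow hwb with ht' | ht'
  · exact hM.not_undir_of_arrow hvb.2 ⟨ht, ht'⟩
  · have hanc : M.anc v w :=
      (Relation.ReflTransGen.single hvb).tail (show M.dir b w from ⟨ht, ht'⟩)
    rcases hM.tail_or_arrow (adj_symm hM.wf (adj_of_mark hvw)) with h | h
    · exact hM.not_dir_of_anc hanc ⟨h, hvw⟩
    · exact hM.not_bidir_of_anc hanc ⟨h, hvw⟩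

theorem adj_of_invisible (hM : M.IsIMAG) (hab : M.dir a b) (hnv : ¬ M.VisibleCond a b)
    {v c : N} (hv : Relation.ReflTransGen (fun p q => M.bidir p q ∧ M.dir p b) v a)
    (hc : M.mark v c = some Mark.arrow) (hcb : c ≠ b) : M.adj c b := by
  by_contra hn
  refine hnv (.inr ⟨c, hcb, hn, ?_⟩)
  obtain ⟨n, f, h0, hl, hr, hinj⟩ := exists_injective_seq_of_reflTransGen hv
  rcases Nat.eq_zero_or_pos n with rfl | hpos
  · left
    rwa [← hl, h0]
  right
  have hfb : ∀ i ≤ n, M.dir (f i) b := by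
    intro i hi
    rcases hi.eq_or_lt with rfl | hi
    · rwa [hl]
    · exact (hr i hi).2
  have hfc : ∀ i ≤ n, f i ≠ c := by
    rintro i hi rfl
    exact hn (adj_of_mark (hfb i hi).1)
  let g : ℕ → N := fun k => if k = 0 then c else f (k - 1)
  have g0 : g 0 = c := rfl
  have gs : ∀ k, g (k + 1) = f k := fun k => by simp [g]
  have hadj : ∀ i < n + 1, M.adj (g i) (g (i + 1)) := by
    rintro (_ | i) hi
    · rw [g0, gs, h0]
      exact adj_symm hM.wf (adj_of_mark hc)
    · rw [gs, gs]
      exact adj_of_mark (hr i (by omega)).1.1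
  refine ⟨⟨n + 1, g, hadj⟩, ?_, Nat.succ_le_succ hpos, g0, (gs n).trans hl, ?_, ?_, ?_⟩
  · rintro (_ | i) hi (_ | j) hj h
    · rfl
    · exact absurd h.symm (by simpa only [g0, gs] using hfc j (by simpa using hj))
    · exact absurd h (by simpa only [g0, gs] using hfc i (by simpa using hi))
    · simp only [gs] at h
      rw [hinj i (by simpa using hi) j (by simpa using hj) h]
  · change M.mark (g 1) (g 0) = _
    rw [g0, gs, h0]
    exact hc
  · rintro (_ | i) h1 hi
    · omega
    · change M.bidir (g (i + 1)) (g (i + 1 + 1))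
      rw [gs, gs]
      exact (hr i (by simpa using hi)).1
  · rintro (_ | i) h1 hi
    · omega
    · change M.dir (g (i + 1)) b
      rw [gs]
      exact (hr i (by simpa using hi)).2

theorem colliderChain_of_invisible (hM : M.IsIMAG) (hab : M.dir a b)
    (hnv : ¬ M.VisibleCond a b) {X : Set N} {x : N} (h : M.ColliderChain X x a) :
    M.ColliderChain X x b := by
  suffices key : ∀ v, M.ColliderChain X x v → M.dir v b →
      Relation.ReflTransGen (fun p q => M.bidir p q ∧ M.dir p b) v a →
      M.ColliderChain X x b from key a h hab .refl
  intro v hc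
  induction hc with
  | @single v h =>
    intro hvb hv
    have hxb : x ≠ b := by
      rintro rfl
      exact absurd (hvb.1.symm.trans h) (by simp)
    exact .single (hM.arrow_of_adj_of_dir hvb h (hM.adj_of_invisible hab hnv hv h hxb))
  | @step w v hxw hw hwv ih =>
    intro hvb hv
    have hwb : w ≠ b := by
      rintro rfl
      exact absurd (hvb.1.symm.trans hwv.2) (by simp)
    have hadj := hM.adj_of_invisible hab hnv hv hwv.2 hwb
    have hbw := hM.arrow_of_adj_of_dir hvb hwv.2 hadj
    rcases hM.tail_or_arrow hadj with h | h
    · exact ih ⟨h, hbw⟩ (.head ⟨hwv, h, hbw⟩ hv)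
    · exact .step hxw hw ⟨h, hbw⟩

end MixedGraph.IsIMAG

/-- `s` is the selection node attached to some undirected edge of `M` at `x`. -/
def SelectionParent {N : Type} (M : MixedGraph N) (σ : Sym2 N → N) (x s : N) : Prop :=
  ∃ y, M.undir x y ∧ s = σ s(x, y)

/-- `x` and `y` are joined by one of the edges `a ↔ σ s(a, a) ↔ b`. -/
def SelectionEdge {N : Type} (σ : Sym2 N → N) (a b x y : N) : Prop :=
  (x = σ s(a, a) ∧ (y = a ∨ y = b)) ∨ (y = σ s(a, a) ∧ (x = a ∨ x = b))

/-- The isADMG obtained from `M` by replacing each undirected edge `x − y` by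
`x → σ s(x, y) ← y` and adding `a ↔ σ s(a, a) ↔ b`, with all new nodes selected. -/
def confoundedSADMG {N : Type} (M : MixedGraph N) (σ : Sym2 N → N) (a b : N) : SADMG N where
  graph :=
    { inputs := M.inputs
      outputs := M.outputs ∪ {s | s = σ s(a, a) ∨ ∃ x, SelectionParent M σ x s}
      mark := fun x y =>
        if M.mark x y = some Mark.arrow ∨ SelectionParent M σ y x ∨ SelectionEdge σ a b x y then
          some Mark.arrow
        else if M.dir x y ∨ SelectionParent M σ x y then some Mark.tail
        else none }
  sel := {s | s = σ s(a, a) ∨ ∃ x, SelectionParent M σ x s}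

/-- Hypotheses under which `confoundedSADMG M σ a b` is represented by `M`. -/
structure Confoundable {N : Type} (M : MixedGraph N) (σ : Sym2 N → N) (a b : N) : Prop where
  isIMAG : M.IsIMAG
  injective : Function.Injective σ
  fresh : ∀ p, σ p ∉ M.nodes
  left_mem : a ∈ M.outputs
  right_mem : b ∈ M.outputs
  invisible_or_undir : (M.dir a b ∧ ¬ M.VisibleCond a b) ∨ M.undir a b

namespace Confoundable

open MixedGraph

variable {N : Type} {M : MixedGraph N} {σ : Sym2 N → N} {a b : N}

local notation "𝒜" => confoundedSADMG M σ a b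

theorem mem_nodes_left (h : Confoundable M σ a b) {x y : N} {m : Mark}
    (hm : M.mark x y = some m) : x ∈ M.nodes :=
  (h.isIMAG.wf.2.2.2.2.2 x y (adj_of_mark hm)).1

theorem mem_nodes_right (h : Confoundable M σ a b) {x y : N} {m : Mark}
    (hm : M.mark x y = some m) : y ∈ M.nodes :=
  (h.isIMAG.wf.2.2.2.2.2 x y (adj_of_mark hm)).2

theorem not_undir_self (h : Confoundable M σ a b) (x : N) : ¬ M.undir x x := by
  intro hu
  have := hu.1
  simp [h.isIMAG.wf.2.2.2.2.1 x] at this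

theorem selectionParent_left (h : Confoundable M σ a b) {x s : N}
    (hp : SelectionParent M σ x s) : x ∈ M.nodes := by
  obtain ⟨y, hu, -⟩ := hp
  exact h.mem_nodes_left hu.1

theorem selectionParent_right (h : Confoundable M σ a b) {x s : N}
    (hp : SelectionParent M σ x s) : s ∉ M.nodes := by
  obtain ⟨y, hu, rfl⟩ := hp
  exact h.fresh _

theorem selectionParent_ne (h : Confoundable M σ a b) {x s : N}
    (hp : SelectionParent M σ x s) : s ≠ σ s(a, a) := by
  obtain ⟨y, hu, rfl⟩ := hp
  intro he
  have := h.injective he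
  simp only [Sym2.eq_iff] at this
  obtain ⟨rfl, rfl⟩ : x = a ∧ y = a := by tauto
  exact h.not_undir_self _ hu

theorem undir_of_selectionParent (h : Confoundable M σ a b) {x y s : N}
    (hx : SelectionParent M σ x s) (hy : SelectionParent M σ y s) (hne : x ≠ y) :
    M.undir x y := by
  obtain ⟨x', hux, rfl⟩ := hx
  obtain ⟨y', huy, he⟩ := hy
  have := h.injective he
  simp only [Sym2.eq_iff] at this
  rcases this with ⟨h1, -⟩ | ⟨-, h2⟩
  · exact absurd h1 hne
  · rwa [h2] at hux

theorem _root_.SelectionEdge.symm {x y : N} (he : SelectionEdge σ a b x y) :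
    SelectionEdge σ a b y x := by
  unfold SelectionEdge at *
  tauto

theorem left_mem_nodes (h : Confoundable M σ a b) : a ∈ M.nodes := .inr h.left_mem

theorem right_mem_nodes (h : Confoundable M σ a b) : b ∈ M.nodes := .inr h.right_mem

theorem selectionEdge_of_mem (h : Confoundable M σ a b) {x y : N}
    (he : SelectionEdge σ a b x y) (hx : x ∈ M.nodes) :
    y = σ s(a, a) ∧ (x = a ∨ x = b) := by
  rcases he with ⟨rfl, -⟩ | he
  · exact absurd hx (h.fresh _)
  · exact he

theorem not_selectionEdge_of_mem (h : Confoundable M σ a b) {x y : N} (hx : x ∈ M.nodes)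
    (hy : y ∈ M.nodes) : ¬ SelectionEdge σ a b x y := by
  intro he
  rw [(h.selectionEdge_of_mem he hx).1] at hy
  exact h.fresh _ hy

theorem not_selectionEdge_of_selectionParent (h : Confoundable M σ a b) {x s y : N}
    (hp : SelectionParent M σ x s) : ¬ SelectionEdge σ a b s y := by
  rintro (⟨hs, -⟩ | ⟨-, rfl | rfl⟩)
  · exact h.selectionParent_ne hp hs
  · exact h.selectionParent_right hp h.left_mem_nodes
  · exact h.selectionParent_right hp h.right_mem_nodes

theorem mark_eq_arrow_iff {x y : N} :
    (𝒜).graph.mark x y = some Mark.arrow ↔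
      M.mark x y = some Mark.arrow ∨ SelectionParent M σ y x ∨ SelectionEdge σ a b x y := by
  simp only [confoundedSADMG]
  split_ifs with h1 h2
  · simpa using h1
  · simpa using h1
  · simpa using h1

theorem mark_eq_tail_iff (h : Confoundable M σ a b) {x y : N} :
    (𝒜).graph.mark x y = some Mark.tail ↔ M.dir x y ∨ SelectionParent M σ x y := by
  simp only [confoundedSADMG]
  split_ifs with h1 h2
  · simp only [Option.some.injEq, reduceCtorEq, false_iff]
    rintro (hd | hp)
    · rcases h1 with h1 | h1 | h1
      · exact absurd (hd.1.symm.trans h1) (by simp)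
      · exact h.selectionParent_right h1 (h.mem_nodes_left hd.1)
      · exact h.not_selectionEdge_of_mem (h.mem_nodes_left hd.1) (h.mem_nodes_right hd.1) h1
    · rcases h1 with h1 | h1 | h1
      · exact h.selectionParent_right hp (h.mem_nodes_right h1)
      · exact h.selectionParent_right h1 (h.selectionParent_left hp)
      · exact h.not_selectionEdge_of_selectionParent hp h1.symm
  · simpa using h2
  · simpa using h2

theorem dir_iff (h : Confoundable M σ a b) {x y : N} :
    (𝒜).graph.dir x y ↔ M.dir x y ∨ SelectionParent M σ x y := by
  rw [dir, h.mark_eq_tail_iff, mark_eq_arrow_iff]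
  constructor
  · exact fun h => h.1
  · rintro (hd | hp)
    · exact ⟨.inl hd, .inl hd.2⟩
    · exact ⟨.inr hp, .inr (.inl hp)⟩

theorem bidir_iff (h : Confoundable M σ a b) {x y : N} :
    (𝒜).graph.bidir x y ↔ M.bidir x y ∨ SelectionEdge σ a b x y := by
  rw [bidir, mark_eq_arrow_iff, mark_eq_arrow_iff]
  constructor
  · rintro ⟨h1 | h1 | h1, h2 | h2 | h2⟩
    · exact .inl ⟨h1, h2⟩
    · exact absurd (h.mem_nodes_right h1) (h.selectionParent_right h2)
    · exact .inr h2.symm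
    · exact absurd (h.mem_nodes_right h2) (h.selectionParent_right h1)
    · exact absurd (h.selectionParent_left h1) (h.selectionParent_right h2)
    · exact .inr h2.symm
    all_goals exact .inr h1
  · rintro (hb | he)
    · exact ⟨.inl hb.1, .inl hb.2⟩
    · exact ⟨.inr (.inr he), .inr (.inr he.symm)⟩

theorem dir_or_dir_or_bidir (h : Confoundable M σ a b) {x y : N} (hadj : (𝒜).graph.adj x y) :
    (𝒜).graph.dir x y ∨ (𝒜).graph.dir y x ∨ (𝒜).graph.bidir x y := by
  obtain ⟨m, hm⟩ := Option.isSome_iff_exists.1 hadj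
  rw [h.dir_iff, h.dir_iff, h.bidir_iff]
  cases m with
  | tail => exact .inl (h.mark_eq_tail_iff.1 hm)
  | arrow =>
    right
    rcases mark_eq_arrow_iff.1 hm with hm | hp | he
    · rcases h.isIMAG.tail_or_arrow (adj_symm h.isIMAG.wf (adj_of_mark hm)) with h' | h'
      · exact .inl (.inl ⟨h', hm⟩)
      · exact .inr (.inl ⟨hm, h'⟩)
    · exact .inl (.inr hp)
    · exact .inr (.inr he)
  | circle =>
    simp only [confoundedSADMG] at hm
    split_ifs at hm <;> simp at hm

theorem anc_cases (h : Confoundable M σ a b) {x y : N} (hxy : (𝒜).graph.anc x y) :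
    M.anc x y ∨ ∃ z, M.anc x z ∧ SelectionParent M σ z y := by
  induction hxy with
  | refl => exact .inl .refl
  | tail _ hd ih =>
    rcases ih with ih | ⟨z, -, hz⟩
    · rcases h.dir_iff.1 hd with hd | hp
      · exact .inl (ih.tail hd)
      · exact .inr ⟨_, ih, hp⟩
    · rcases h.dir_iff.1 hd with hd | hp
      · exact absurd (h.mem_nodes_left hd.1) (h.selectionParent_right hz)
      · exact absurd (h.selectionParent_left hp) (h.selectionParent_right hz)

theorem anc_of_mem (h : Confoundable M σ a b) {x y : N} (hxy : (𝒜).graph.anc x y)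
    (hy : y ∈ M.nodes) : M.anc x y := by
  rcases h.anc_cases hxy with h' | ⟨z, -, hz⟩
  · exact h'
  · exact absurd hy (h.selectionParent_right hz)

theorem anc_of_anc (h : Confoundable M σ a b) {x y : N} (hxy : M.anc x y) :
    (𝒜).graph.anc x y :=
  Relation.ReflTransGen.mono (fun _ _ hd => h.dir_iff.2 (.inl hd)) _ _ hxy

theorem mem_nodes_of_anc (h : Confoundable M σ a b) {x y : N} (hxy : M.anc x y)
    (hy : y ∈ M.nodes) : x ∈ M.nodes := by
  rcases Relation.ReflTransGen.cases_head hxy with rfl | ⟨z, hz, -⟩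
  · exact hy
  · exact h.mem_nodes_left hz.1

theorem sel_disjoint (h : Confoundable M σ a b) {s : N} (hs : s ∈ (𝒜).sel) : s ∉ M.nodes := by
  rcases hs with rfl | ⟨x, hx⟩
  · exact h.fresh _
  · exact h.selectionParent_right hx

theorem sel_finite (h : Confoundable M σ a b) : (𝒜).sel.Finite := by
  have hf : M.nodes.Finite := h.isIMAG.wf.2.1.union h.isIMAG.wf.2.2.1
  refine (((hf.prod hf).image fun p => σ s(p.1, p.2)).insert (σ s(a, a))).subset ?_
  rintro s (rfl | ⟨x, y, hu, rfl⟩)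
  · exact .inl rfl
  · exact .inr ⟨(x, y), ⟨h.mem_nodes_left hu.1, h.mem_nodes_right hu.1⟩, rfl⟩

theorem mem_nodes_of_adj (h : Confoundable M σ a b) {x y : N} (hadj : (𝒜).graph.adj x y) :
    x ∈ (𝒜).graph.nodes := by
  have hin : ∀ {z}, z ∈ M.nodes → z ∈ (𝒜).graph.nodes := by
    rintro z (hz | hz)
    · exact .inl hz
    · exact .inr (.inl hz)
  rcases h.dir_or_dir_or_bidir hadj with h' | h' | h'
  · rcases h.dir_iff.1 h' with hd | hp
    · exact hin (h.mem_nodes_left hd.1)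
    · exact hin (h.selectionParent_left hp)
  · rcases h.dir_iff.1 h' with hd | hp
    · exact hin (h.mem_nodes_left hd.2)
    · exact .inr (.inr (.inr ⟨_, hp⟩))
  · rcases h.bidir_iff.1 h' with hd | ⟨rfl, -⟩ | ⟨-, rfl | rfl⟩
    · exact hin (h.mem_nodes_left hd.1)
    · exact .inr (.inr (.inl rfl))
    · exact hin h.left_mem_nodes
    · exact hin h.right_mem_nodes

theorem graph_wf (h : Confoundable M σ a b) : (𝒜).graph.WF := by
  have hM := h.isIMAG.wf
  have hsymm : ∀ x y, (𝒜).graph.adj x y → (𝒜).graph.adj y x := by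
    intro x y hadj
    rcases h.dir_or_dir_or_bidir hadj with h' | h' | h'
    · exact adj_of_mark h'.2
    · exact adj_of_mark h'.1
    · exact adj_of_mark h'.2
  refine ⟨?_, hM.2.1, hM.2.2.1.union h.sel_finite, hsymm, fun x => ?_,
    fun x y hadj => ⟨h.mem_nodes_of_adj hadj, h.mem_nodes_of_adj (hsymm x y hadj)⟩⟩
  · refine Set.disjoint_union_right.2 ⟨hM.1, Set.disjoint_left.2 fun x hx hs => ?_⟩
    exact h.sel_disjoint hs (.inl hx)
  · by_contra hn
    have hMx : ∀ m, M.mark x x ≠ some m := by simp [hM.2.2.2.2.1 x]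
    have hp : ¬ SelectionParent M σ x x := fun hp =>
      h.selectionParent_right hp (h.selectionParent_left hp)
    rcases h.dir_or_dir_or_bidir (Option.isSome_iff_ne_none.2 hn) with h' | h' | h'
    · rcases h.dir_iff.1 h' with hd | hp'
      · exact hMx _ hd.1
      · exact hp hp'
    · rcases h.dir_iff.1 h' with hd | hp'
      · exact hMx _ hd.1
      · exact hp hp'
    · rcases h.bidir_iff.1 h' with hd | he
      · exact hMx _ hd.1
      · by_cases hx : x ∈ M.nodes
        · exact h.not_selectionEdge_of_mem hx hx he
        · rcases he with ⟨-, rfl | rfl⟩ | ⟨-, rfl | rfl⟩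
          all_goals first | exact hx h.left_mem_nodes | exact hx h.right_mem_nodes

theorem wf (h : Confoundable M σ a b) : (𝒜).WF := by
  refine ⟨⟨h.graph_wf, fun x y => h.dir_or_dir_or_bidir, fun x y hd hyx => ?_,
    fun x hx y hm => ?_, fun x hx y hy hadj => ?_⟩, Set.subset_union_right⟩
  · rcases h.dir_iff.1 hd with hd | hp
    · exact h.isIMAG.not_dir_of_anc (h.anc_of_mem hyx (h.mem_nodes_left hd.1)) hd
    · have hx := h.selectionParent_left hp
      exact h.selectionParent_right hp (h.mem_nodes_of_anc (h.anc_of_mem hyx hx) hx)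
  · have hxn : x ∈ M.nodes := .inl hx
    rcases mark_eq_arrow_iff.1 hm with hm | hp | he
    · exact h.isIMAG.1.2.1 x hx y hm
    · exact h.selectionParent_right hp hxn
    · rcases (h.selectionEdge_of_mem he hxn).2 with rfl | rfl
      · exact Set.disjoint_left.1 h.isIMAG.wf.1 hx h.left_mem
      · exact Set.disjoint_left.1 h.isIMAG.wf.1 hx h.right_mem
  · have hno := h.isIMAG.1.2.2.1
    rcases h.dir_or_dir_or_bidir hadj with h' | h' | h'
    · rcases h.dir_iff.1 h' with hd | hp
      · exact hno x hx y hy (adj_of_mark hd.1)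
      · exact h.selectionParent_right hp (.inl hy)
    · rcases h.dir_iff.1 h' with hd | hp
      · exact hno x hx y hy (adj_of_mark hd.2)
      · exact h.selectionParent_right hp (.inl hx)
    · rcases h.bidir_iff.1 h' with hd | he
      · exact hno x hx y hy (adj_of_mark hd.1)
      · exact h.not_selectionEdge_of_mem (.inl hx) (.inl hy) he

theorem not_mem_ancSet_sel_of_arrow (h : Confoundable M σ a b) {x y : N}
    (hm : M.mark x y = some Mark.arrow) : x ∉ (𝒜).graph.ancSet (𝒜).sel := by
  rintro ⟨s, hs, hxs⟩
  rcases h.anc_cases hxs with hanc | ⟨z, hanc, w, hu, -⟩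
  · rcases Relation.ReflTransGen.cases_tail hanc with rfl | ⟨z, -, hz⟩
    · exact h.sel_disjoint hs (h.mem_nodes_left hm)
    · exact h.sel_disjoint hs (h.mem_nodes_right hz.1)
  · rcases Relation.ReflTransGen.cases_tail hanc with rfl | ⟨z', -, hz⟩
    · exact h.isIMAG.not_undir_of_arrow hm hu
    · exact h.isIMAG.not_undir_of_arrow hz.2 hu

theorem not_mem_ancSet_of_arrow (h : Confoundable M σ a b) {x y : N}
    (hm : M.mark x y = some Mark.arrow) : x ∉ (𝒜).graph.ancSet ({y} ∪ (𝒜).sel) := by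
  rintro ⟨s, rfl | hs, hxs⟩
  · have hanc := h.anc_of_mem hxs (h.mem_nodes_right hm)
    rcases h.isIMAG.tail_or_arrow (adj_symm h.isIMAG.wf (adj_of_mark hm)) with h' | h'
    · exact h.isIMAG.not_dir_of_anc hanc ⟨h', hm⟩
    · exact h.isIMAG.not_bidir_of_anc hanc ⟨h', hm⟩
  · exact h.not_mem_ancSet_sel_of_arrow hm ⟨s, hs, hxs⟩

theorem mem_ancSet_sel_of_undir (h : Confoundable M σ a b) {x y : N} (hu : M.undir x y) :
    x ∈ (𝒜).graph.ancSet (𝒜).sel :=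
  ⟨σ s(x, y), .inr ⟨x, y, hu, rfl⟩, .single (h.dir_iff.2 (.inr ⟨y, hu, rfl⟩))⟩

theorem mem_ancSet_of_tail (h : Confoundable M σ a b) {x y : N}
    (hm : M.mark x y = some Mark.tail) : x ∈ (𝒜).graph.ancSet ({y} ∪ (𝒜).sel) := by
  rcases h.isIMAG.tail_or_arrow (adj_symm h.isIMAG.wf (adj_of_mark hm)) with h' | h'
  · exact ancSet_mono Set.subset_union_right (h.mem_ancSet_sel_of_undir ⟨hm, h'⟩)
  · exact ⟨y, .inl rfl, h.anc_of_anc (.single ⟨hm, h'⟩)⟩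

theorem inducing_of_adj (h : Confoundable M σ a b) {x y : N} (hadj : M.adj x y) :
    (𝒜).graph.Inducing (𝒜).sel x y := by
  have hadj' := adj_symm h.isIMAG.wf hadj
  rcases h.isIMAG.tail_or_arrow hadj with hx | hx
  · rcases h.isIMAG.tail_or_arrow hadj' with hy | hy
    · have hp : SelectionParent M σ x (σ s(x, y)) := ⟨y, ⟨hx, hy⟩, rfl⟩
      have hq : SelectionParent M σ y (σ s(x, y)) := ⟨x, ⟨hy, hx⟩, by rw [Sym2.eq_swap]⟩
      exact .inr ⟨_, mem_ancSet_self (.inr (.inr ⟨x, hp⟩)),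
        .single (mark_eq_arrow_iff.2 (.inr (.inl hp))), mark_eq_arrow_iff.2 (.inr (.inl hq))⟩
    · exact .inl (adj_of_mark (h.dir_iff.2 (.inl ⟨hx, hy⟩)).1)
  · exact .inl (adj_of_mark (mark_eq_arrow_iff.2 (.inl hx)))

theorem mem_ancSet_of_mem_ancSet (h : Confoundable M σ a b) {x y u z : N} (hx : x ∈ M.nodes)
    (hy : y ∈ M.nodes) (hu : u ∈ (𝒜).graph.ancSet ({x, y} ∪ (𝒜).sel))
    (hm : M.mark u z = some Mark.arrow) : u ∈ M.ancSet ({x, y} ∪ ∅) := by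
  obtain ⟨s, hs | hs, hanc⟩ := hu
  · refine ⟨s, .inl hs, h.anc_of_mem hanc ?_⟩
    rcases hs with rfl | rfl
    · exact hx
    · exact hy
  · exact absurd ⟨s, hs, hanc⟩ (h.not_mem_ancSet_sel_of_arrow hm)

theorem colliderChain_ancSet (h : Confoundable M σ a b) {x y u v : N} (hx : x ∈ M.nodes)
    (hy : y ∈ M.nodes) (hc : M.ColliderChain ((𝒜).graph.ancSet ({x, y} ∪ (𝒜).sel)) u v) :
    M.ColliderChain (M.ancSet ({x, y} ∪ ∅)) u v := by
  induction hc with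
  | single hm => exact .single hm
  | step hc hw hb ih => exact .step ih (h.mem_ancSet_of_mem_ancSet hx hy hw hb.1) hb

theorem adj_of_end (h : Confoundable M σ a b) {x y : N} (hne : x ≠ y) (hx : x ∈ M.nodes)
    (hy : y ∈ M.nodes) (hc : M.ColliderChain ((𝒜).graph.ancSet ({x, y} ∪ (𝒜).sel)) x y) :
    M.adj x y :=
  h.isIMAG.adj_of_inducing hne hx hy
    ((h.colliderChain_ancSet hx hy hc).inducing_of_end h.isIMAG.wf)

theorem adj_of_meet (h : Confoundable M σ a b) {x y v : N} (hne : x ≠ y) (hx : x ∈ M.nodes)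
    (hy : y ∈ M.nodes) (hxv : M.ColliderChain ((𝒜).graph.ancSet ({x, y} ∪ (𝒜).sel)) x v)
    (hyv : M.ColliderChain ((𝒜).graph.ancSet ({x, y} ∪ (𝒜).sel)) y v)
    (hv : v ∈ (𝒜).graph.ancSet ({x, y} ∪ (𝒜).sel)) : M.adj x y := by
  obtain ⟨u, hu, hxu, hm⟩ := hyv.exists_meet hxv hv
  exact h.isIMAG.adj_of_inducing hne hx hy (.inr ⟨u, h.mem_ancSet_of_mem_ancSet hx hy hu hm,
    h.colliderChain_ancSet hx hy hxu, hm⟩)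

/-- `v` is `x` or the end of a collider chain starting at `x`. -/
def Reaches (M : MixedGraph N) (X : Set N) (x v : N) : Prop := x = v ∨ M.ColliderChain X x v

theorem Reaches.step {X : Set N} {x w v : N} (hr : Reaches M X x w) (hw : w ∈ X)
    (hb : M.bidir w v) : Reaches M X x v := by
  rcases hr with rfl | hc
  · exact .inr (.single hb.2)
  · exact .inr (.step hc hw hb)

theorem Reaches.trans {X : Set N} {x u v : N} (hr : Reaches M X x u)
    (hc : M.BidirChain X u v) : Reaches M X x v := by
  induction hc with
  | refl => exact hr
  | tail _ hb ih => exact ih.step hb.1 hb.2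

/-- Reachability from `x` along collider chains that may pass through `a ↔ σ s(a, a) ↔ b`. -/
def ReachesVia (M : MixedGraph N) (a b : N) (X : Set N) (x v : N) : Prop :=
  Reaches M X x v ∨ (Reaches M X x a ∧ a ∈ X ∧ M.BidirChain X b v) ∨
    (Reaches M X x b ∧ b ∈ X ∧ M.BidirChain X a v)

theorem ReachesVia.step {X : Set N} {x w v : N} (hr : ReachesVia M a b X x w) (hw : w ∈ X)
    (hb : M.bidir w v) : ReachesVia M a b X x v := by
  rcases hr with hr | ⟨hr, ha, hc⟩ | ⟨hr, ha, hc⟩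
  · exact .inl (hr.step hw hb)
  · exact .inr (.inl ⟨hr, ha, hc.tail ⟨hw, hb⟩⟩)
  · exact .inr (.inr ⟨hr, ha, hc.tail ⟨hw, hb⟩⟩)

theorem ReachesVia.reaches_left_or_right {X : Set N} {x w : N} (hr : ReachesVia M a b X x w)
    (hw : w ∈ X) (hwab : w = a ∨ w = b) :
    (Reaches M X x a ∧ a ∈ X) ∨ (Reaches M X x b ∧ b ∈ X) := by
  rcases hr with hr | ⟨hr, ha, -⟩ | ⟨hr, ha, -⟩
  · rcases hwab with rfl | rfl
    · exact .inl ⟨hr, hw⟩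
    · exact .inr ⟨hr, hw⟩
  · exact .inl ⟨hr, ha⟩
  · exact .inr ⟨hr, ha⟩

theorem colliderChain_cases (h : Confoundable M σ a b) {X : Set N} {x v : N} (hx : x ∈ M.nodes)
    (hxX : x ∈ X) (hc : (𝒜).graph.ColliderChain X x v) :
    (v ∈ M.nodes ∧ ReachesVia M a b X x v) ∨
      (v = σ s(a, a) ∧ ((Reaches M X x a ∧ a ∈ X) ∨ (Reaches M X x b ∧ b ∈ X))) ∨
      SelectionParent M σ x v := by
  induction hc with
  | single hm =>
    rcases mark_eq_arrow_iff.1 hm with hm | hp | he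
    · exact .inl ⟨h.mem_nodes_left hm, .inl (.inr (.single hm))⟩
    · exact .inr (.inr hp)
    · obtain ⟨rfl, rfl | rfl⟩ := h.selectionEdge_of_mem he.symm hx
      · exact .inr (.inl ⟨rfl, .inl ⟨.inl rfl, hxX⟩⟩)
      · exact .inr (.inl ⟨rfl, .inr ⟨.inl rfl, hxX⟩⟩)
  | @step w v _ hw hb ih =>
    rcases h.bidir_iff.1 hb with hb | he
    · have hwn := h.mem_nodes_left hb.1
      rcases ih with ⟨-, ih⟩ | ⟨rfl, -⟩ | hp
      · exact .inl ⟨h.mem_nodes_right hb.1, ih.step hw hb⟩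
      · exact absurd hwn (h.fresh _)
      · exact absurd hwn (h.selectionParent_right hp)
    · rcases ih with ⟨hwn, ih⟩ | ⟨rfl, ih⟩ | hp
      · obtain ⟨rfl, hwab⟩ := h.selectionEdge_of_mem he hwn
        exact .inr (.inl ⟨rfl, ih.reaches_left_or_right hw hwab⟩)
      · left
        rcases he with ⟨-, rfl | rfl⟩ | ⟨-, hs | hs⟩
        · refine ⟨h.left_mem_nodes, ?_⟩
          rcases ih with ih | ih
          · exact .inl ih.1
          · exact .inr (.inr ⟨ih.1, ih.2, .refl⟩)
        · refine ⟨h.right_mem_nodes, ?_⟩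
          rcases ih with ih | ih
          · exact .inr (.inl ⟨ih.1, ih.2, .refl⟩)
          · exact .inl ih.1
        · exact absurd (hs ▸ h.left_mem_nodes) (h.fresh _)
        · exact absurd (hs ▸ h.right_mem_nodes) (h.fresh _)
      · exact absurd he (h.not_selectionEdge_of_selectionParent hp)

theorem adj_of_reaches (h : Confoundable M σ a b) {x y v : N} (hne : x ≠ y) (hx : x ∈ M.nodes)
    (hy : y ∈ M.nodes) (hr : Reaches M ((𝒜).graph.ancSet ({x, y} ∪ (𝒜).sel)) x v)
    (hyv : M.ColliderChain ((𝒜).graph.ancSet ({x, y} ∪ (𝒜).sel)) y v)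
    (hv : v ∈ (𝒜).graph.ancSet ({x, y} ∪ (𝒜).sel)) : M.adj x y := by
  rcases hr with rfl | hr
  · rw [Set.pair_comm] at hyv
    exact adj_symm h.isIMAG.wf (h.adj_of_end hne.symm hy hx hyv)
  · exact h.adj_of_meet hne hx hy hr hyv hv

theorem dir_of_arrow_left (h : Confoundable M σ a b) {z : N} (hm : M.mark a z = some Mark.arrow) :
    M.dir a b ∧ ¬ M.VisibleCond a b :=
  h.invisible_or_undir.resolve_right (h.isIMAG.not_undir_of_arrow hm)

theorem dir_of_arrow_right (h : Confoundable M σ a b) {z : N}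
    (hm : M.mark b z = some Mark.arrow) : M.dir a b ∧ ¬ M.VisibleCond a b :=
  h.invisible_or_undir.resolve_right fun hu => h.isIMAG.not_undir_of_arrow hm ⟨hu.2, hu.1⟩

theorem colliderChain_right (h : Confoundable M σ a b) {X : Set N} {x : N}
    (hc : M.ColliderChain X x a) : M.ColliderChain X x b := by
  obtain ⟨z, hz⟩ := hc.arrowAt
  obtain ⟨hd, hnv⟩ := h.dir_of_arrow_left hz
  exact h.isIMAG.colliderChain_of_invisible hd hnv hc

theorem reaches_right_of_dir (h : Confoundable M σ a b) {X : Set N} {x : N} (hd : M.dir a b)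
    (hr : Reaches M X x a) : M.ColliderChain X x b := by
  rcases hr with rfl | hc
  · exact .single hd.2
  · exact h.colliderChain_right hc

theorem adj_left_right (h : Confoundable M σ a b) : M.adj a b := by
  rcases h.invisible_or_undir with h | h
  · exact adj_of_mark h.1.1
  · exact adj_of_mark h.1

theorem start_mem_of_bidirChain {X : Set N} {u v : N} (hc : M.BidirChain X u v) (hv : v ∈ X) :
    u ∈ X := by
  rcases Relation.ReflTransGen.cases_head hc with rfl | ⟨w, hw, -⟩
  · exact hv
  · exact hw.1

theorem adj_of_reachesVia (h : Confoundable M σ a b) {x y v : N} (hne : x ≠ y) (hx : x ∈ M.nodes)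
    (hy : y ∈ M.nodes) (hr : ReachesVia M a b ((𝒜).graph.ancSet ({x, y} ∪ (𝒜).sel)) x v)
    (hv : v ∈ (𝒜).graph.ancSet ({x, y} ∪ (𝒜).sel)) (hm : M.mark v y = some Mark.arrow) :
    M.adj x y := by
  rcases hr with hr | ⟨hr, -, hc⟩ | ⟨hr, hb, hc⟩
  · exact h.adj_of_reaches hne hx hy hr (.single hm) hv
  · have hyb := (ColliderChain.single hm).trans (hc.symm hv)
    obtain ⟨z, hz⟩ := hyb.arrowAt
    exact h.adj_of_meet hne hx hy (h.reaches_right_of_dir (h.dir_of_arrow_right hz).1 hr) hyb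
      (start_mem_of_bidirChain hc hv)
  · exact h.adj_of_reaches hne hx hy hr
      (h.colliderChain_right ((ColliderChain.single hm).trans (hc.symm hv))) hb

theorem adj_of_reaches_pair (h : Confoundable M σ a b) {x y : N} (hne : x ≠ y) (hx : x ∈ M.nodes)
    (hy : y ∈ M.nodes) (hyab : y = a ∨ y = b)
    (hr : Reaches M ((𝒜).graph.ancSet ({x, y} ∪ (𝒜).sel)) x a ∨
      Reaches M ((𝒜).graph.ancSet ({x, y} ∪ (𝒜).sel)) x b ∧
        b ∈ (𝒜).graph.ancSet ({x, y} ∪ (𝒜).sel)) : M.adj x y := by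
  rcases hyab with rfl | rfl
  · rcases hr with (rfl | hc) | ⟨rfl | hc, hb⟩
    · exact absurd rfl hne
    · exact h.adj_of_end hne hx hy hc
    · exact adj_symm h.isIMAG.wf h.adj_left_right
    · obtain ⟨z, hz⟩ := hc.arrowAt
      exact h.adj_of_meet hne hx hy hc (.single (h.dir_of_arrow_right hz).1.2) hb
  · rcases hr with (rfl | hc) | ⟨rfl | hc, hb⟩
    · exact h.adj_left_right
    · exact h.adj_of_end hne hx hy (h.colliderChain_right hc)
    · exact absurd rfl hne
    · exact h.adj_of_end hne hx hy hc

theorem adj_of_inducing (h : Confoundable M σ a b) {x y : N} (hne : x ≠ y) (hx : x ∈ M.nodes)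
    (hy : y ∈ M.nodes) (hi : (𝒜).graph.Inducing (𝒜).sel x y) : M.adj x y := by
  rcases hi with hadj | ⟨v, hv, hc, hm⟩
  · rcases h.dir_or_dir_or_bidir hadj with h' | h' | h'
    · rcases h.dir_iff.1 h' with hd | hp
      · exact adj_of_mark hd.1
      · exact absurd hy (h.selectionParent_right hp)
    · rcases h.dir_iff.1 h' with hd | hp
      · exact adj_of_mark hd.2
      · exact absurd hx (h.selectionParent_right hp)
    · rcases h.bidir_iff.1 h' with hb | he
      · exact adj_of_mark hb.1
      · exact absurd he (h.not_selectionEdge_of_mem hx hy)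
  · rcases h.colliderChain_cases hx (mem_ancSet_self (.inl (.inl rfl))) hc with
      ⟨hvn, hr⟩ | ⟨rfl, hr⟩ | hp
    · rcases mark_eq_arrow_iff.1 hm with hm | hp | he
      · exact h.adj_of_reachesVia hne hx hy hr hv hm
      · exact absurd hvn (h.selectionParent_right hp)
      · exact absurd he (h.not_selectionEdge_of_mem hvn hy)
    · rcases mark_eq_arrow_iff.1 hm with hm | hp | he
      · exact absurd (h.mem_nodes_left hm) (h.fresh _)
      · exact absurd rfl (h.selectionParent_ne hp)
      · exact h.adj_of_reaches_pair hne hx hy (h.selectionEdge_of_mem he.symm hy).2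
          (hr.imp_left And.left)
    · rcases mark_eq_arrow_iff.1 hm with hm | hp' | he
      · exact absurd (h.mem_nodes_left hm) (h.selectionParent_right hp)
      · exact adj_of_mark (h.undir_of_selectionParent hp hp' hne).1
      · exact absurd he (h.not_selectionEdge_of_selectionParent hp)

theorem representsS (h : Confoundable M σ a b) : RepresentsS M 𝒜 := by
  refine ⟨rfl, ?_, fun x y hne hx hy => ?_, fun x y => h.not_mem_ancSet_of_arrow,
    fun x y => h.mem_ancSet_of_tail⟩
  · refine (Set.union_sdiff_cancel_right ?_).symm
    exact fun s hs => h.sel_disjoint hs.2 (.inr hs.1)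
  · rw [inducingPathBtw_iff hne h.wf.1.1]
    exact ⟨fun hadj => ⟨fun hI => h.isIMAG.1.2.2.1 x hI.1 y hI.2 hadj, h.inducing_of_adj hadj⟩,
      fun hi => h.adj_of_inducing hne hx hy hi.2⟩

theorem regimeAdj (h : Confoundable M σ a b) : (𝒜).RegimeAdj a b := by
  have hab : M.mark a b = some Mark.tail := by
    rcases h.invisible_or_undir with h | h
    · exact h.1.1
    · exact h.1
  have haX := h.mem_ancSet_of_tail hab
  exact ⟨haX, σ s(a, a), mem_ancSet_self (.inr (.inl rfl)),
    .single ⟨haX, h.bidir_iff.2 (.inr (.inr ⟨rfl, .inl rfl⟩))⟩,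
    mark_eq_arrow_iff.2 (.inr (.inr (.inl ⟨rfl, .inr rfl⟩)))⟩

end Confoundable

theorem exists_injective_sym2_avoiding {N : Type} [Infinite N] {s : Set N} (hs : s.Finite) :
    ∃ σ : Sym2 N → N, Function.Injective σ ∧ ∀ p, σ p ∉ s := by
  have hle : Cardinal.mk (Sym2 N) ≤ Cardinal.mk ((sᶜ : Set N)) := by
    rw [Cardinal.mk_compl_of_infinite s (hs.lt_aleph0.trans_le (Cardinal.aleph0_le_mk N))]
    exact (Cardinal.mk_le_of_surjective (f := fun p : N × N => s(p.1, p.2))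
      (fun p => p.ind fun x y => ⟨(x, y), rfl⟩)).trans_eq
        ((Cardinal.mk_prod N N).trans (by simp))
  obtain ⟨f⟩ := hle
  exact ⟨fun p => f p, Subtype.val_injective.comp f.injective, fun p => (f p).2⟩

theorem MixedGraph.IsIMAG.exists_confoundable {N : Type} [Infinite N] {M : MixedGraph N}
    (hM : M.IsIMAG) {a b : N} (ha : a ∈ M.outputs) (hb : b ∈ M.outputs)
    (h : (M.dir a b ∧ ¬ M.VisibleCond a b) ∨ M.undir a b) : ∃ σ, Confoundable M σ a b := by
  obtain ⟨σ, hσ, hf⟩ := exists_injective_sym2_avoiding (hM.wf.2.1.union hM.wf.2.2.1)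
  exact ⟨σ, hM, hσ, hf, ha, hb, h⟩

/-- Let `M` be an iMAG, `a` an output node, and `b` another output
node.  Then: (1) `I_a → b` is in `MAG(A_{do(I_a)})` for some `A ∈ [M]_G` iff
`a → b` is an invisible directed edge of `M`; (2) `I_a − b` is in
`MAG(A_{do(I_a)})` for some `A ∈ [M]_G` iff `a − b` is in `M`; (3) `I_a` and `b`
are adjacent in `MAG(A_{do(I_a)})` for some `A ∈ [M]_G` iff `a → b` is invisible
in `M` or `a − b` is in `M`. -/
theorem statement8 {N : Type} [Infinite N] (M : MixedGraph N) (hM : M.IsIMAG)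
    (a b : N) (ha : a ∈ M.outputs) (hb : b ∈ M.outputs) (hne : b ≠ a) :
    ((∃ A : SADMG N, A.WF ∧ RepresentsS M A ∧
        ∃ M' : MixedGraph (N ⊕ N), M'.IsIMAG ∧ RepresentsS M' (A.softManip {a}) ∧
          M'.dir (Sum.inr a) (Sum.inl b)) ↔
      (M.dir a b ∧ ¬ M.VisibleCond a b)) ∧
    ((∃ A : SADMG N, A.WF ∧ RepresentsS M A ∧
        ∃ M' : MixedGraph (N ⊕ N), M'.IsIMAG ∧ RepresentsS M' (A.softManip {a}) ∧
          M'.undir (Sum.inr a) (Sum.inl b)) ↔ M.undir a b) ∧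
    ((∃ A : SADMG N, A.WF ∧ RepresentsS M A ∧
        ∃ M' : MixedGraph (N ⊕ N), M'.IsIMAG ∧ RepresentsS M' (A.softManip {a}) ∧
          M'.adj (Sum.inr a) (Sum.inl b)) ↔
      ((M.dir a b ∧ ¬ M.VisibleCond a b) ∨ M.undir a b)) := by
  have hfwd : ∀ A : SADMG N, RepresentsS M A → a ∈ A.graph.outputs ∧ b ∈ A.obs := fun A hR =>
    ⟨(hR.2.1 ▸ ha : a ∈ A.obs).1, hR.2.1 ▸ hb⟩
  have hdir : (∃ A : SADMG N, A.WF ∧ RepresentsS M A ∧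
        ∃ M' : MixedGraph (N ⊕ N), M'.IsIMAG ∧ RepresentsS M' (A.softManip {a}) ∧
          M'.dir (Sum.inr a) (Sum.inl b)) ↔
      (M.dir a b ∧ ¬ M.VisibleCond a b) := by
    constructor
    · rintro ⟨A, hA, hR, M', hM', hR', hd⟩
      obtain ⟨haA, hbA⟩ := hfwd A hR
      obtain ⟨hr, hbS⟩ := (hR'.softManip_dir_iff hA haA hbA hne hM').1 hd
      exact ⟨hR.dir_of_regimeAdj hM hA ha hb hne hr hbS,
        hR.not_visibleCond_of_regimeAdj hM hA ha hb hr⟩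
    · intro h
      obtain ⟨σ, hσ⟩ := hM.exists_confoundable ha hb (.inl h)
      obtain ⟨haA, hbA⟩ := hfwd _ hσ.representsS
      have hW := hσ.wf.softManip haA
      exact ⟨_, hσ.wf, hσ.representsS, _, SADMG.mag_isIMAG hW, SADMG.mag_representsS hW,
        ((SADMG.mag_representsS hW).softManip_dir_iff hσ.wf haA hbA hne
          (SADMG.mag_isIMAG hW)).2 ⟨hσ.regimeAdj, hσ.not_mem_ancSet_sel_of_arrow h.1.2⟩⟩
  have hundir : (∃ A : SADMG N, A.WF ∧ RepresentsS M A ∧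
        ∃ M' : MixedGraph (N ⊕ N), M'.IsIMAG ∧ RepresentsS M' (A.softManip {a}) ∧
          M'.undir (Sum.inr a) (Sum.inl b)) ↔ M.undir a b := by
    constructor
    · rintro ⟨A, hA, hR, M', hM', hR', hu⟩
      obtain ⟨haA, hbA⟩ := hfwd A hR
      obtain ⟨hr, hbS⟩ := (hR'.softManip_undir_iff hA haA hbA hne hM').1 hu
      exact hR.undir_of_regimeAdj hM hA ha hb hne hr hbS
    · intro h
      obtain ⟨σ, hσ⟩ := hM.exists_confoundable ha hb (.inr h)
      obtain ⟨haA, hbA⟩ := hfwd _ hσ.representsS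
      have hW := hσ.wf.softManip haA
      exact ⟨_, hσ.wf, hσ.representsS, _, SADMG.mag_isIMAG hW, SADMG.mag_representsS hW,
        ((SADMG.mag_representsS hW).softManip_undir_iff hσ.wf haA hbA hne
          (SADMG.mag_isIMAG hW)).2 ⟨hσ.regimeAdj, hσ.mem_ancSet_sel_of_undir ⟨h.2, h.1⟩⟩⟩
  refine ⟨hdir, hundir, ?_, ?_⟩
  · rintro ⟨A, hA, hR, M', hM', hR', hadj⟩
    obtain ⟨haA, hbA⟩ := hfwd A hR
    have hr := (hR'.softManip_adj_iff hA haA hbA hne).1 hadj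
    by_cases hbS : b ∈ A.graph.ancSet A.sel
    · exact .inr (hR.undir_of_regimeAdj hM hA ha hb hne hr hbS)
    · exact .inl ⟨hR.dir_of_regimeAdj hM hA ha hb hne hr hbS,
        hR.not_visibleCond_of_regimeAdj hM hA ha hb hr⟩
  · rintro (h | h)
    · obtain ⟨A, hA, hR, M', hM', hR', hd⟩ := hdir.2 h
      exact ⟨A, hA, hR, M', hM', hR', MixedGraph.adj_of_mark hd.1⟩
    · obtain ⟨A, hA, hR, M', hM', hR', hd⟩ := hundir.2 h
      exact ⟨A, hA, hR, M', hM', hR', MixedGraph.adj_of_mark hd.1⟩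

end
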